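/- arXiv:1405.5779 — 3 statements merged into one kernel-verified Lean document; each statement's English description precedes it below -/
import Mathlib

section
/- Nonnegativity of the Riesz–Feller heat kernel (G^α_θ(·,t) is a stable probability density): Let 0 < α ≤ 2, |θ| ≤ min{α, 2−α}, and (α, θ) ∉ {(1,1), (1,−1)}. Then for every t > 0 and every x ∈ ℝ, G^α_θ(x,t) ≥ 0, where G^α_θ(x,t) = (1/(2π)) ∫_ℝ e^{−iξx}·e^{t·ψ^α_θ(ξ)} dξ. -/
open MeasureTheory Real Filter

/-- Riesz–Feller symbol `ψ^α_θ(ξ) = -|ξ|^α exp(i sgn(ξ) θ π/2)`. -/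
noncomputable def rfSymbol (α θ : ℝ) (ξ : ℝ) : ℂ :=
  -((|ξ| ^ α : ℝ) : ℂ) * Complex.exp (Complex.I * (Real.sign ξ : ℂ) * (θ : ℂ) * ((π / 2 : ℝ) : ℂ))

/-- Riesz–Feller heat kernel (as a complex number)
`G^α_θ(x,t) = (1/(2π)) ∫ e^{-iξx} e^{tψ^α_θ(ξ)} dξ`. -/
noncomputable def heatG (α θ : ℝ) (x t : ℝ) : ℂ :=
  ((1 / (2 * π) : ℝ) : ℂ) *
    ∫ ξ : ℝ, Complex.exp (-Complex.I * (ξ : ℂ) * (x : ℂ)) * Complex.exp ((t : ℂ) * rfSymbol α θ ξ)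

/-- The real-valued Riesz–Feller heat kernel. -/
noncomputable def heatKer (α θ : ℝ) (x t : ℝ) : ℝ := (heatG α θ x t).re


/-- Integrable functions whose Fourier transform has nonnegative real part. -/
def RR (f : ℝ → ℂ) : Prop :=
  Integrable f ∧ ∀ x : ℝ, 0 ≤ (∫ ξ : ℝ, Complex.exp (-Complex.I * (ξ : ℂ) * (x : ℂ)) * f ξ).re

/-- Multipliers bounded by `B` that preserve `RR`. -/
def MM (g : ℝ → ℂ) (B : ℝ) : Prop :=
  Measurable g ∧ (∀ ξ, ‖g ξ‖ ≤ B) ∧ ∀ f, RR f → RR (fun ξ => f ξ * g ξ)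

lemma norm_char (ξ x : ℝ) : ‖Complex.exp (-Complex.I * (ξ : ℂ) * (x : ℂ))‖ = 1 := by
  rw [Complex.norm_exp]; simp

lemma integrable_char_mul {f : ℝ → ℂ} (hf : Integrable f) (x : ℝ) :
    Integrable (fun ξ : ℝ => Complex.exp (-Complex.I * (ξ : ℂ) * (x : ℂ)) * f ξ) := by
  refine hf.bdd_mul (c := 1) ?_ ?_
  · exact (by fun_prop : Continuous fun ξ : ℝ =>
      Complex.exp (-Complex.I * (ξ : ℂ) * (x : ℂ))).aestronglyMeasurable
  · exact Filter.Eventually.of_forall fun ξ => (norm_char ξ x).le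

lemma RR.lim {f : ℝ → ℂ} {F : ℕ → ℝ → ℂ} {b : ℝ → ℝ} (hF : ∀ n, RR (F n))
    (hb : Integrable b) (hbd : ∀ n ξ, ‖F n ξ‖ ≤ b ξ)
    (hl : ∀ ξ, Tendsto (fun n => F n ξ) atTop (nhds (f ξ))) : RR f := by
  have hm : AEStronglyMeasurable f :=
    aestronglyMeasurable_of_tendsto_ae atTop (fun n => (hF n).1.1)
      (Filter.Eventually.of_forall hl)
  refine ⟨?_, fun x => ?_⟩
  · refine hb.mono' hm (Filter.Eventually.of_forall fun ξ => ?_)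
    exact le_of_tendsto (hl ξ).norm (Filter.Eventually.of_forall fun n => hbd n ξ)
  · have := tendsto_integral_of_dominated_convergence (μ := volume) b
      (F := fun n (ξ : ℝ) => Complex.exp (-Complex.I * (ξ : ℂ) * (x : ℂ)) * F n ξ)
      (f := fun (ξ : ℝ) => Complex.exp (-Complex.I * (ξ : ℂ) * (x : ℂ)) * f ξ)
      (fun n => (integrable_char_mul (hF n).1 x).1) hb
      (fun n => Filter.Eventually.of_forall fun ξ => by
        rw [norm_mul, norm_char, one_mul]; exact hbd n ξ)
      (Filter.Eventually.of_forall fun ξ => (hl ξ).const_mul _)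
    exact ge_of_tendsto' ((Complex.continuous_re.tendsto _).comp this) fun n => (hF n).2 x

lemma MM.mono {g : ℝ → ℂ} {B B' : ℝ} (h : MM g B) (hB : B ≤ B') : MM g B' :=
  ⟨h.1, fun ξ => (h.2.1 ξ).trans hB, h.2.2⟩

lemma MM.nonneg {g : ℝ → ℂ} {B : ℝ} (h : MM g B) : 0 ≤ B :=
  (norm_nonneg _).trans (h.2.1 0)

lemma MM.lim {g : ℝ → ℂ} {G : ℕ → ℝ → ℂ} {B : ℝ} (h : ∀ n, MM (G n) B)
    (hl : ∀ ξ, Tendsto (fun n => G n ξ) atTop (nhds (g ξ))) : MM g B := by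
  refine ⟨measurable_of_tendsto_metrizable (fun n => (h n).1) (tendsto_pi_nhds.2 hl),
    fun ξ => le_of_tendsto (hl ξ).norm (Filter.Eventually.of_forall fun n => (h n).2.1 ξ),
    fun f hf => ?_⟩
  refine RR.lim (F := fun n ξ => f ξ * G n ξ) (b := fun ξ => ‖f ξ‖ * B)
    (fun n => (h n).2.2 f hf) (hf.1.norm.mul_const B) (fun n ξ => ?_) (fun ξ => (hl ξ).const_mul _)
  rw [norm_mul]
  exact mul_le_mul_of_nonneg_left ((h n).2.1 ξ) (norm_nonneg _)

lemma MM.char {c : ℝ} (hc : 0 ≤ c) (l : ℝ) :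
    MM (fun ξ : ℝ => (c : ℂ) * Complex.exp (Complex.I * l * ξ)) c := by
  have hn : ∀ ξ : ℝ, ‖(c : ℂ) * Complex.exp (Complex.I * l * ξ)‖ = c := by
    intro ξ
    rw [norm_mul, Complex.norm_exp]; simp [abs_of_nonneg hc]
  refine ⟨by fun_prop, fun ξ => (hn ξ).le, fun f hf => ⟨?_, fun x => ?_⟩⟩
  · refine hf.1.mul_bdd (c := c) ?_ (Filter.Eventually.of_forall fun ξ => (hn ξ).le)
    exact (by fun_prop : Continuous fun ξ : ℝ =>
      (c : ℂ) * Complex.exp (Complex.I * l * ξ)).aestronglyMeasurable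
  · have h := hf.2 (x - l)
    have e : ∀ ξ : ℝ, Complex.exp (-Complex.I * (ξ : ℂ) * (x : ℂ)) *
        (f ξ * ((c : ℂ) * Complex.exp (Complex.I * l * ξ))) =
        (c : ℂ) * (Complex.exp (-Complex.I * (ξ : ℂ) * ((x - l : ℝ) : ℂ)) * f ξ) := by
      intro ξ
      have : Complex.exp (-Complex.I * (ξ : ℂ) * ((x - l : ℝ) : ℂ)) =
        Complex.exp (-Complex.I * (ξ : ℂ) * (x : ℂ)) * Complex.exp (Complex.I * l * ξ) := by
        rw [← Complex.exp_add]; congr 1; push_cast; ring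
      rw [this]; ring
    simp_rw [e]
    rw [integral_const_mul, Complex.re_ofReal_mul]
    exact mul_nonneg hc h

lemma MM.const {c : ℝ} (hc : 0 ≤ c) : MM (fun _ : ℝ => (c : ℂ)) c := by
  simpa using MM.char hc 0

lemma MM.mul {g h : ℝ → ℂ} {A B : ℝ} (hg : MM g A) (hh : MM h B) :
    MM (fun ξ => g ξ * h ξ) (A * B) := by
  refine ⟨hg.1.mul hh.1, fun ξ => ?_, fun f hf => ?_⟩
  · rw [norm_mul]
    exact mul_le_mul (hg.2.1 ξ) (hh.2.1 ξ) (norm_nonneg _) hg.nonneg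
  · have := hh.2.2 _ (hg.2.2 f hf)
    simpa only [mul_assoc] using this

lemma MM.add {g h : ℝ → ℂ} {A B : ℝ} (hg : MM g A) (hh : MM h B) :
    MM (fun ξ => g ξ + h ξ) (A + B) := by
  refine ⟨hg.1.add hh.1, fun ξ => (norm_add_le _ _).trans (add_le_add (hg.2.1 ξ) (hh.2.1 ξ)),
    fun f hf => ?_⟩
  have h1 := hg.2.2 f hf
  have h2 := hh.2.2 f hf
  refine ⟨?_, fun x => ?_⟩
  · simp only [mul_add]
    exact h1.1.add h2.1
  · simp only [mul_add]
    rw [integral_add (integrable_char_mul h1.1 x) (integrable_char_mul h2.1 x), Complex.add_re]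
    exact add_nonneg (h1.2 x) (h2.2 x)

lemma MM.pow {g : ℝ → ℂ} {A : ℝ} (hg : MM g A) (n : ℕ) :
    MM (fun ξ => g ξ ^ n) (A ^ n) := by
  induction n with
  | zero => simpa using MM.const (c := 1) zero_le_one
  | succ n ih => simpa only [pow_succ] using ih.mul hg

lemma MM.sum {g : ℕ → ℝ → ℂ} {A : ℕ → ℝ} (hg : ∀ n, MM (g n) (A n)) (N : ℕ) :
    MM (fun ξ => ∑ n ∈ Finset.range N, g n ξ) (∑ n ∈ Finset.range N, A n) := by
  induction N with
  | zero => simpa using MM.const (c := 0) le_rfl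
  | succ n ih => simpa only [Finset.sum_range_succ] using ih.add (hg n)

lemma MM.hasSum {g : ℕ → ℝ → ℂ} {A : ℕ → ℝ} {S : ℝ} {G : ℝ → ℂ} (hg : ∀ n, MM (g n) (A n))
    (hA : HasSum A S) (hG : ∀ ξ, HasSum (fun n => g n ξ) (G ξ)) : MM G S :=
  MM.lim (G := fun N ξ => ∑ n ∈ Finset.range N, g n ξ)
    (fun N => (MM.sum hg N).mono (sum_le_hasSum _ (fun n _ => (hg n).nonneg) hA))
    (fun ξ => (hG ξ).tendsto_sum_nat)

lemma MM.exp {g : ℝ → ℂ} {A : ℝ} (hg : MM g A) :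
    MM (fun ξ => Complex.exp (g ξ)) (Real.exp A) := by
  refine MM.hasSum (g := fun n ξ => ((1 / (n.factorial : ℝ) : ℝ) : ℂ) * g ξ ^ n)
    (A := fun n => (1 / (n.factorial : ℝ)) * A ^ n)
    (fun n => (MM.const (by positivity)).mul (hg.pow n)) ?_ (fun ξ => ?_)
  · rw [Real.exp_eq_exp_ℝ]
    have := NormedSpace.expSeries_div_hasSum_exp A
    refine this.congr_fun ?_ |> fun h => h
    intro n; ring
  · rw [Complex.exp_eq_exp_ℂ]
    have := NormedSpace.expSeries_div_hasSum_exp (g ξ)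
    refine this.congr_fun ?_ |> fun h => h
    intro n; push_cast; ring

lemma RR_gauss {e : ℝ} (he : 0 < e) : RR (fun ξ : ℝ => Complex.exp (-(e : ℂ) * (ξ : ℂ) ^ 2)) := by
  refine ⟨?_, fun x => ?_⟩
  · simpa using integrable_cexp_quadratic (b := (e : ℂ)) (by simpa using he) 0 0
  · have h := fourierIntegral_gaussian (b := (e : ℂ)) (by simpa using he) (-x : ℂ)
    have e1 : ∀ ξ : ℝ, Complex.exp (-Complex.I * (ξ : ℂ) * (x : ℂ)) =
      Complex.exp (Complex.I * (-x : ℂ) * ξ) := fun ξ => by congr 1; ring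
    simp_rw [e1]
    rw [h]
    have e2 : ((π : ℂ) / e) ^ (1 / 2 : ℂ) = (((π / e) ^ (1 / 2 : ℝ) : ℝ) : ℂ) := by
      rw [Complex.ofReal_cpow (by positivity)]; push_cast; rfl
    have e3 : Complex.exp (-(-x : ℂ) ^ 2 / (4 * e)) = ((Real.exp (-(-x) ^ 2 / (4 * e)) : ℝ) : ℂ) := by
      push_cast; rfl
    rw [e2, e3, ← Complex.ofReal_mul, Complex.ofReal_re]
    positivity

/-- Coefficients of `(1 - w) ^ α`. -/
noncomputable def dd (α : ℝ) (k : ℕ) : ℝ := (-1) ^ k * Ring.choose α k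

lemma dd_zero (α : ℝ) : dd α 0 = 1 := by simp [dd]

lemma dd_one (α : ℝ) : dd α 1 = -α := by simp [dd]

lemma dd_succ (α : ℝ) (k : ℕ) : dd α (k + 1) = dd α k * ((k - α) / (k + 1)) := by
  have h := Ring.choose_smul_choose α (n := k + 1) (k := k) (Nat.le_succ k)
  simp at h
  have : ((k : ℝ) + 1) ≠ 0 := by positivity
  unfold dd
  have h' : Ring.choose α (k + 1) = Ring.choose α k * (α - k) / (k + 1) := by
    field_simp; linarith
  rw [h']; ring

lemma dd_nonpos {α : ℝ} (h0 : 0 < α) (h1 : α < 1) (k : ℕ) : dd α (k + 1) ≤ 0 := by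
  induction k with
  | zero => rw [zero_add, dd_one]; linarith
  | succ k ih =>
    rw [dd_succ]
    refine mul_nonpos_of_nonpos_of_nonneg ih (div_nonneg ?_ (by positivity))
    push_cast; have : (0 : ℝ) ≤ k := by positivity
    linarith

lemma dd_nonneg {α : ℝ} (h0 : 1 < α) (h1 : α < 2) (k : ℕ) : 0 ≤ dd α (k + 2) := by
  induction k with
  | zero =>
    rw [zero_add, dd_succ, dd_one]
    have : -α * (((1 : ℕ) - α) / ((1 : ℕ) + 1)) = α * (α - 1) / 2 := by push_cast; ring
    rw [this]
    exact div_nonneg (mul_nonneg (by linarith) (by linarith)) (by norm_num)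
  | succ k ih =>
    rw [show k + 1 + 2 = (k + 2) + 1 by ring, dd_succ]
    refine mul_nonneg ih (div_nonneg ?_ (by positivity))
    push_cast; have : (0 : ℝ) ≤ k := by positivity
    linarith

lemma hasSum_dd (α : ℝ) {w : ℂ} (hw : ‖w‖ < 1) :
    HasSum (fun k => (dd α k : ℂ) * w ^ k) ((1 - w) ^ (α : ℂ)) := by
  have h := (Complex.one_add_cpow_hasFPowerSeriesOnBall_zero (a := (α : ℂ))).hasSum (y := -w)
    (by rw [← ENNReal.ofReal_one, Metric.eball_ofReal]; simpa using hw)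
  simp only [zero_add, binomialSeries_apply] at h
  rw [← sub_eq_add_neg] at h
  refine h.congr_fun ?_ |> fun h => h
  intro k
  simp only [dd, List.ofFn_const, List.prod_replicate, smul_eq_mul]
  push_cast
  rw [neg_pow w]; ring

lemma hasSum_dd_real (α : ℝ) {r : ℝ} (h0 : 0 ≤ r) (h1 : r < 1) :
    HasSum (fun k => dd α k * r ^ k) ((1 - r) ^ α) := by
  have h := hasSum_dd α (w := (r : ℂ)) (by simpa [abs_of_nonneg h0] using h1)
  rw [← Complex.hasSum_ofReal]
  rw [Complex.ofReal_cpow (by linarith)]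
  push_cast
  exact h

lemma hasSum_cast {E : Type*} [AddCommMonoid E] [TopologicalSpace E] {f g : ℕ → E} {a b : E}
    (h : HasSum f a) (h1 : ∀ k, g k = f k) (h2 : b = a) : HasSum g b := by
  rw [h2, funext h1]; exact h

lemma norm_r_char {r : ℝ} (h0 : 0 ≤ r) (l ξ : ℝ) :
    ‖(r : ℂ) * Complex.exp (Complex.I * l * ξ)‖ = r := by
  rw [norm_mul, Complex.norm_exp]; simp [abs_of_nonneg h0]

lemma core_lt {α : ℝ} (h0 : 0 < α) (h1 : α < 1) {s r : ℝ} (hs : 0 ≤ s) (hr0 : 0 ≤ r) (hr1 : r < 1)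
    (l : ℝ) : MM (fun ξ : ℝ => Complex.exp
      (-(s * (1 - (r : ℂ) * Complex.exp (Complex.I * l * ξ)) ^ (α : ℂ)))) 1 := by
  have hA := ((hasSum_nat_add_iff' 1).2 (hasSum_dd_real α hr0 hr1)).neg
  have H : MM (fun ξ : ℝ => 1 - (1 - (r : ℂ) * Complex.exp (Complex.I * l * ξ)) ^ (α : ℂ))
      (1 - (1 - r) ^ α) := by
    refine MM.hasSum (A := fun k => -(dd α (k + 1) * r ^ (k + 1)))
      (g := fun k ξ => ((-(dd α (k + 1) * r ^ (k + 1)) : ℝ) : ℂ) *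
        Complex.exp (Complex.I * (((k + 1) * l : ℝ) : ℂ) * ξ)) (fun k => ?_) ?_ (fun ξ => ?_)
    · refine MM.char ?_ _
      have := mul_nonpos_of_nonpos_of_nonneg (dd_nonpos h0 h1 k) (pow_nonneg hr0 (k + 1))
      linarith
    · refine hasSum_cast hA (fun k => rfl) ?_
      simp [dd_zero]
    · have hB := ((hasSum_nat_add_iff' 1).2 (hasSum_dd α
        (w := (r : ℂ) * Complex.exp (Complex.I * l * ξ)) (by rwa [norm_r_char hr0]))).neg
      refine hasSum_cast hB (fun k => ?_) ?_
      · rw [mul_pow, ← Complex.exp_nat_mul]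
        push_cast
        rw [show Complex.I * (((k : ℂ) + 1) * l) * ξ = (k + 1) * (Complex.I * l * ξ) by ring]
        ring
      · simp [dd_zero]
  have h3 := ((MM.const hs).mul H).exp.mul (MM.const (Real.exp_pos (-s)).le)
  have hb : Real.exp (s * (1 - (1 - r) ^ α)) * Real.exp (-s) ≤ 1 := by
    rw [← Real.exp_add, Real.exp_le_one_iff]
    have : 0 ≤ s * (1 - r) ^ α := mul_nonneg hs (Real.rpow_nonneg (by linarith) _)
    linarith
  convert h3.mono hb using 1
  ext ξ
  push_cast
  rw [← Complex.exp_add]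
  congr 1; ring

lemma core_gt {α : ℝ} (h0 : 1 < α) (h1 : α < 2) {s r : ℝ} (hs : 0 ≤ s) (hr0 : 0 ≤ r) (hr1 : r < 1)
    (l : ℝ) : MM (fun ξ : ℝ => Complex.exp
      (s * (Complex.exp (-(Complex.I * l * ξ)) *
        (1 - (r : ℂ) * Complex.exp (Complex.I * l * ξ)) ^ (α : ℂ)))) (Real.exp (s * (1 - r) ^ α)) := by
  have hA := ((hasSum_nat_add_iff' 2).2 (hasSum_dd_real α hr0 hr1))
  have H : MM (fun ξ : ℝ => Complex.exp (-(Complex.I * l * ξ)) *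
      ((1 - (r : ℂ) * Complex.exp (Complex.I * l * ξ)) ^ (α : ℂ)
        - (1 - α * (r * Complex.exp (Complex.I * l * ξ)))))
      ((1 - r) ^ α - (1 - α * r)) := by
    refine MM.hasSum (A := fun k => dd α (k + 2) * r ^ (k + 2))
      (g := fun k ξ => ((dd α (k + 2) * r ^ (k + 2) : ℝ) : ℂ) *
        Complex.exp (Complex.I * (((k + 1) * l : ℝ) : ℂ) * ξ)) (fun k => ?_) ?_ (fun ξ => ?_)
    · exact MM.char (mul_nonneg (dd_nonneg h0 h1 k) (pow_nonneg hr0 (k + 2))) _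
    · refine hasSum_cast hA (fun k => rfl) ?_
      simp [Finset.sum_range_succ, dd_zero, dd_one]; ring
    · have hB := ((hasSum_nat_add_iff' 2).2 (hasSum_dd α
        (w := (r : ℂ) * Complex.exp (Complex.I * l * ξ)) (by rwa [norm_r_char hr0]))).mul_left
          (Complex.exp (-(Complex.I * l * ξ)))
      refine hasSum_cast hB (fun k => ?_) ?_
      · rw [mul_pow, ← Complex.exp_nat_mul]
        push_cast
        rw [show Complex.I * (((k : ℂ) + 1) * l) * ξ =
          -(Complex.I * l * ξ) + (k + 2) * (Complex.I * l * ξ) by ring, Complex.exp_add]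
        ring
      · simp [Finset.sum_range_succ, dd_zero, dd_one]; ring
  have H2 := H.add (MM.char zero_le_one (-l))
  have h3 := ((MM.const hs).mul H2).exp.mul (MM.const (Real.exp_pos (-(s * (α * r)))).le)
  have hb : Real.exp (s * ((1 - r) ^ α - (1 - α * r) + 1)) * Real.exp (-(s * (α * r)))
      = Real.exp (s * (1 - r) ^ α) := by
    rw [← Real.exp_add]; congr 1; ring
  rw [hb] at h3
  convert h3 using 1
  ext ξ
  push_cast
  rw [← Complex.exp_add]
  congr 1
  rw [show Complex.I * -(l : ℂ) * ξ = -(Complex.I * l * ξ) by ring]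
  have : Complex.exp (-(Complex.I * l * ξ)) * Complex.exp (Complex.I * l * ξ) = 1 := by
    rw [← Complex.exp_add]; simp
  linear_combination (-(s : ℂ) * α * r) * this

lemma real_mul_cpow {a α : ℝ} (ha : 0 < a) (hα : 0 < α) (w : ℂ) :
    ((a : ℂ) * w) ^ (α : ℂ) = ((a ^ α : ℝ) : ℂ) * w ^ (α : ℂ) := by
  have hα' : (α : ℂ) ≠ 0 := by exact_mod_cast hα.ne'
  have ha' : (a : ℂ) ≠ 0 := by exact_mod_cast ha.ne'
  by_cases hw : w = 0
  · simp [hw, Complex.zero_cpow hα']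
  · rw [Complex.ofReal_cpow ha.le, Complex.cpow_def_of_ne_zero (mul_ne_zero ha' hw),
      Complex.cpow_def_of_ne_zero ha', Complex.cpow_def_of_ne_zero hw,
      Complex.log_ofReal_mul ha hw, ← Complex.exp_add, Complex.ofReal_log ha.le, add_mul]

/-- step size -/
noncomputable def hh (n : ℕ) : ℝ := 1 / ((n : ℝ) + 1)

lemma hh_pos (n : ℕ) : 0 < hh n := by unfold hh; positivity

lemma hh_le (n : ℕ) : hh n ≤ 1 := by
  unfold hh
  rw [div_le_one (by positivity)]
  have : (0 : ℝ) ≤ n := by positivity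
  linarith

lemma hh_tendsto : Tendsto hh atTop (nhds 0) := tendsto_one_div_add_atTop_nhds_zero_nat

lemma hh_r0 (n : ℕ) : 0 ≤ 1 - hh n ^ 2 := by
  have h1 := hh_pos n
  have h2 := hh_le n
  nlinarith

lemma hh_r1 (n : ℕ) : 1 - hh n ^ 2 < 1 := by
  have h1 := hh_pos n
  nlinarith

lemma base_tendsto (σ ξ : ℝ) : Tendsto (fun n => (((hh n)⁻¹ : ℝ) : ℂ) *
    (1 - ((1 - hh n ^ 2 : ℝ) : ℂ) * Complex.exp (Complex.I * ((σ * hh n : ℝ) : ℂ) * ξ)))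
    atTop (nhds (-(Complex.I * σ * ξ))) := by
  have hne : Tendsto hh atTop (nhdsWithin 0 {0}ᶜ) :=
    tendsto_nhdsWithin_iff.2 ⟨hh_tendsto, Filter.Eventually.of_forall fun n => (hh_pos n).ne'⟩
  have hd : HasDerivAt (fun h : ℝ => Complex.exp (Complex.I * σ * ξ * (h : ℂ)))
      (Complex.I * σ * ξ) 0 := by
    have h1 : HasDerivAt (fun h : ℝ => Complex.I * σ * ξ * (h : ℂ)) (Complex.I * σ * ξ) 0 := by
      simpa using (Complex.ofRealCLM.hasDerivAt (x := (0 : ℝ))).const_mul (Complex.I * σ * ξ)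
    simpa using h1.cexp
  have h2 := hd.tendsto_slope_zero.comp hne
  have h3 : Tendsto (fun n => (hh n : ℂ) * Complex.exp (Complex.I * σ * ξ * (hh n : ℂ)))
      atTop (nhds (0 * Complex.exp (Complex.I * σ * ξ * 0))) := by
    have h4 : Tendsto (fun n => (hh n : ℂ)) atTop (nhds 0) := by
      simpa [Function.comp_def] using (Complex.continuous_ofReal.tendsto 0).comp hh_tendsto
    exact h4.mul ((Complex.continuous_exp.tendsto _).comp (h4.const_mul _))
  have h5 := h2.neg.add h3
  simp only [zero_mul, add_zero] at h5
  refine h5.congr fun n => ?_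
  have hz : (hh n : ℂ) ≠ 0 := by exact_mod_cast (hh_pos n).ne'
  simp only [Function.comp_apply, zero_add, Complex.real_smul]
  push_cast
  rw [show Complex.I * (σ * (hh n : ℂ)) * ξ = Complex.I * σ * ξ * (hh n : ℂ) by ring]
  simp only [mul_zero, Complex.exp_zero]
  field_simp
  ring

lemma base_cpow_tendsto {α : ℝ} (hα : 0 < α) (σ ξ : ℝ) : Tendsto (fun n =>
    ((((hh n)⁻¹ ^ α : ℝ)) : ℂ) *
    (1 - ((1 - hh n ^ 2 : ℝ) : ℂ) * Complex.exp (Complex.I * ((σ * hh n : ℝ) : ℂ) * ξ)) ^ (α : ℂ))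
    atTop (nhds ((-(Complex.I * σ * ξ)) ^ (α : ℂ))) := by
  have hc : ContinuousAt (fun x : ℂ => x ^ (α : ℂ)) (-(Complex.I * σ * ξ)) :=
    Complex.continuousAt_cpow_const_of_re_pos (Or.inl (by simp)) (by simpa using hα)
  refine (hc.tendsto.comp (base_tendsto σ ξ)).congr fun n => ?_
  exact real_mul_cpow (inv_pos.2 (hh_pos n)) hα _

lemma stable_lt {α : ℝ} (h0 : 0 < α) (h1 : α < 1) {t : ℝ} (ht : 0 ≤ t) (σ : ℝ) :
    MM (fun ξ : ℝ => Complex.exp (-(t * (-(Complex.I * σ * ξ)) ^ (α : ℂ)))) 1 := by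
  refine MM.lim (fun n => core_lt h0 h1 (s := t * (hh n)⁻¹ ^ α)
    (mul_nonneg ht (Real.rpow_nonneg (inv_pos.2 (hh_pos n)).le _)) (hh_r0 n) (hh_r1 n) (σ * hh n))
    fun ξ => ?_
  refine ((Complex.continuous_exp.tendsto _).comp
    (((base_cpow_tendsto h0 σ ξ).const_mul (t : ℂ)).neg)).congr fun n => ?_
  simp only [Function.comp_apply]
  push_cast
  congr 1; ring

lemma stable_gt {α : ℝ} (h0 : 1 < α) (h1 : α < 2) {t : ℝ} (ht : 0 ≤ t) (σ : ℝ) :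
    MM (fun ξ : ℝ => Complex.exp (t * (-(Complex.I * σ * ξ)) ^ (α : ℂ))) (Real.exp t) := by
  have hα : 0 < α := by linarith
  refine MM.lim (fun n => (core_gt h0 h1 (s := t * (hh n)⁻¹ ^ α)
    (mul_nonneg ht (Real.rpow_nonneg (inv_pos.2 (hh_pos n)).le _)) (hh_r0 n) (hh_r1 n)
      (σ * hh n)).mono ?_) fun ξ => ?_
  · rw [Real.exp_le_exp, mul_assoc, ← Real.mul_rpow (inv_pos.2 (hh_pos n)).le (by simp; positivity)]
    have : (hh n)⁻¹ * (1 - (1 - hh n ^ 2)) = hh n := by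
      have := (hh_pos n).ne'
      field_simp; ring
    rw [this]
    exact mul_le_of_le_one_right ht (Real.rpow_le_one (hh_pos n).le (hh_le n) hα.le)
  · have h4 : Tendsto (fun n => Complex.exp (-(Complex.I * ((σ * hh n : ℝ) : ℂ) * ξ))) atTop
        (nhds 1) := by
      have hc : Continuous fun h : ℝ => Complex.exp (-(Complex.I * ((σ * h : ℝ) : ℂ) * ξ)) := by
        fun_prop
      simpa [Function.comp_def] using (hc.tendsto 0).comp hh_tendsto
    have h5 := (h4.mul (base_cpow_tendsto hα σ ξ)).const_mul (t : ℂ)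
    rw [one_mul] at h5
    refine ((Complex.continuous_exp.tendsto _).comp h5).congr fun n => ?_
    simp only [Function.comp_apply]
    push_cast
    congr 1; ring

lemma cpow_I {α : ℝ} (hα : 0 < α) (ξ : ℝ) : (Complex.I * ξ) ^ (α : ℂ) =
    ((|ξ| ^ α : ℝ) : ℂ) * Complex.exp ((Real.sign ξ * (α * (π / 2)) : ℝ) * Complex.I) := by
  rcases lt_trichotomy ξ 0 with h | h | h
  · rw [show Complex.I * (ξ : ℂ) = ((-ξ : ℝ) : ℂ) * (-Complex.I) by push_cast; ring,
      real_mul_cpow (by linarith) hα, abs_of_neg h, Real.sign_of_neg h,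
      Complex.cpow_def_of_ne_zero (by simp), Complex.log_neg_I]
    congr 2; push_cast; ring
  · subst h
    have hα' : (α : ℂ) ≠ 0 := by exact_mod_cast hα.ne'
    simp [Complex.zero_cpow hα', Real.zero_rpow hα.ne']
  · rw [mul_comm Complex.I, real_mul_cpow h hα, abs_of_pos h, Real.sign_of_pos h,
      Complex.cpow_def_of_ne_zero (by simp), Complex.log_I]
    congr 2; push_cast; ring

lemma symbol_decomp {α : ℝ} (hα : 0 < α) (θ ξ : ℝ) :
    ((Real.sin (α * π) : ℝ) : ℂ) * rfSymbol α θ ξ =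
      -(((Real.sin ((α + θ) * (π / 2)) : ℝ) : ℂ) * (-(Complex.I * ((-1 : ℝ) : ℂ) * ξ)) ^ (α : ℂ) +
        ((Real.sin ((α - θ) * (π / 2)) : ℝ) : ℂ) *
          (-(Complex.I * ((1 : ℝ) : ℂ) * ξ)) ^ (α : ℂ)) := by
  have e1 : -(Complex.I * ((-1 : ℝ) : ℂ) * ξ) = Complex.I * ξ := by push_cast; ring
  have e2 : -(Complex.I * ((1 : ℝ) : ℂ) * ξ) = Complex.I * ((-ξ : ℝ) : ℂ) := by push_cast; ring
  rw [e1, e2, cpow_I hα, cpow_I hα, abs_neg, Real.sign_neg, rfSymbol]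
  have e3 : Complex.I * (Real.sign ξ : ℂ) * (θ : ℂ) * ((π / 2 : ℝ) : ℂ) =
    ((Real.sign ξ * (θ * (π / 2)) : ℝ) : ℂ) * Complex.I := by push_cast; ring
  rw [e3, show α * π = 2 * (α * (π / 2)) by ring, add_mul, sub_mul, Real.sin_add, Real.sin_sub,
    Real.sin_two_mul]
  generalize α * (π / 2) = a
  generalize θ * (π / 2) = b
  rcases lt_trichotomy ξ 0 with h | h | h
  · rw [Real.sign_of_neg h]
    simp only [Complex.exp_mul_I, ← Complex.ofReal_cos, ← Complex.ofReal_sin, neg_mul, one_mul,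
      Real.cos_neg, Real.sin_neg, neg_neg]
    push_cast; ring
  · subst h
    simp [Real.zero_rpow hα.ne']
  · rw [Real.sign_of_pos h]
    simp only [Complex.exp_mul_I, ← Complex.ofReal_cos, ← Complex.ofReal_sin, neg_mul, one_mul,
      Real.cos_neg, Real.sin_neg, neg_neg]
    push_cast; ring

lemma MM_lt {α θ : ℝ} (h0 : 0 < α) (h1 : α < 1) (hθ : |θ| ≤ α) {t : ℝ} (ht : 0 ≤ t) :
    MM (fun ξ : ℝ => Complex.exp (t * rfSymbol α θ ξ)) 1 := by
  obtain ⟨ha, hb⟩ := abs_le.1 hθ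
  have hp := Real.pi_pos
  have hk : 0 < Real.sin (α * π) := Real.sin_pos_of_pos_of_lt_pi (by positivity) (by nlinarith)
  have hA : 0 ≤ Real.sin ((α + θ) * (π / 2)) :=
    Real.sin_nonneg_of_nonneg_of_le_pi (mul_nonneg (by linarith) (by positivity)) (by nlinarith)
  have hB : 0 ≤ Real.sin ((α - θ) * (π / 2)) :=
    Real.sin_nonneg_of_nonneg_of_le_pi (mul_nonneg (by linarith) (by positivity)) (by nlinarith)
  have H := (stable_lt h0 h1 (t := t * (Real.sin ((α + θ) * (π / 2)) / Real.sin (α * π)))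
    (by positivity) (-1)).mul (stable_lt h0 h1
      (t := t * (Real.sin ((α - θ) * (π / 2)) / Real.sin (α * π))) (by positivity) 1)
  rw [one_mul] at H
  convert H using 1
  ext ξ
  rw [← Complex.exp_add]
  congr 1
  have hk' : ((Real.sin (α * π) : ℝ) : ℂ) ≠ 0 := by exact_mod_cast hk.ne'
  have hd := symbol_decomp h0 θ ξ
  rw [mul_comm, ← eq_div_iff hk'] at hd
  rw [hd, Complex.ofReal_mul, Complex.ofReal_mul, Complex.ofReal_div, Complex.ofReal_div]
  ring

lemma MM_gt {α θ : ℝ} (h0 : 1 < α) (h1 : α < 2) (hθ : |θ| ≤ 2 - α) {t : ℝ} (ht : 0 ≤ t) :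
    ∃ B, MM (fun ξ : ℝ => Complex.exp (t * rfSymbol α θ ξ)) B := by
  obtain ⟨ha, hb⟩ := abs_le.1 hθ
  have hp := Real.pi_pos
  have hk : 0 < -Real.sin (α * π) := by
    rw [← Real.sin_sub_pi]
    exact Real.sin_pos_of_pos_of_lt_pi (by nlinarith) (by nlinarith)
  have hA : 0 ≤ Real.sin ((α + θ) * (π / 2)) :=
    Real.sin_nonneg_of_nonneg_of_le_pi (mul_nonneg (by linarith) (by positivity)) (by nlinarith)
  have hB : 0 ≤ Real.sin ((α - θ) * (π / 2)) :=
    Real.sin_nonneg_of_nonneg_of_le_pi (mul_nonneg (by linarith) (by positivity)) (by nlinarith)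
  have H := (stable_gt h0 h1 (t := t * (Real.sin ((α + θ) * (π / 2)) / -Real.sin (α * π)))
    (mul_nonneg ht (div_nonneg hA hk.le)) (-1)).mul (stable_gt h0 h1
      (t := t * (Real.sin ((α - θ) * (π / 2)) / -Real.sin (α * π)))
      (mul_nonneg ht (div_nonneg hB hk.le)) 1)
  refine ⟨_, Eq.mp (congrArg (fun g => MM g _) ?_) H⟩
  ext ξ
  symm
  rw [← Complex.exp_add]
  congr 1
  have hk' : ((Real.sin (α * π) : ℝ) : ℂ) ≠ 0 := by
    have : Real.sin (α * π) ≠ 0 := by linarith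
    exact_mod_cast this
  have hd := symbol_decomp (α := α) (by linarith) θ ξ
  rw [mul_comm, ← eq_div_iff hk'] at hd
  rw [hd, Complex.ofReal_mul, Complex.ofReal_mul, Complex.ofReal_div, Complex.ofReal_div,
    Complex.ofReal_neg (Real.sin (α * π)), div_neg, div_neg]
  ring

lemma MM_one {θ : ℝ} (hθ : |θ| < 1) {t : ℝ} (ht : 0 ≤ t) :
    MM (fun ξ : ℝ => Complex.exp (t * rfSymbol 1 θ ξ)) 1 := by
  have hn := abs_nonneg θ
  have hlim : Tendsto (fun n => 1 - (1 - |θ|) * (hh n / 2)) atTop (nhds (1 : ℝ)) := by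
    simpa using ((hh_tendsto.div_const 2).const_mul (1 - |θ|)).const_sub 1
  refine MM.lim (G := fun n ξ => Complex.exp (t * rfSymbol (1 - (1 - |θ|) * (hh n / 2)) θ ξ))
    (fun n => MM_lt ?_ ?_ ?_ ht) fun ξ => ?_
  · have := hh_pos n; have := hh_le n; nlinarith
  · have := hh_pos n; nlinarith
  · have := hh_pos n; have := hh_le n; nlinarith
  · have h1 : Tendsto (fun n => |ξ| ^ (1 - (1 - |θ|) * (hh n / 2))) atTop (nhds (|ξ| ^ (1 : ℝ))) :=
      tendsto_const_nhds.rpow hlim (Or.inr one_pos)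
    refine (Complex.continuous_exp.tendsto _).comp (Tendsto.const_mul _ ?_)
    unfold rfSymbol
    exact (((Complex.continuous_ofReal.tendsto _).comp h1).neg).mul_const _

lemma RR_of_MM {g : ℝ → ℂ} {B : ℝ} (h : MM g B) (hi : Integrable g) : RR g := by
  refine RR.lim (F := fun n ξ => Complex.exp (-(hh n : ℂ) * (ξ : ℂ) ^ 2) * g ξ)
    (b := fun ξ => ‖g ξ‖) (fun n => h.2.2 _ (RR_gauss (hh_pos n))) hi.norm (fun n ξ => ?_)
    (fun ξ => ?_)
  · rw [norm_mul]
    refine mul_le_of_le_one_left (norm_nonneg _) ?_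
    rw [Complex.norm_exp, Real.exp_le_one_iff]
    have : (-(hh n : ℂ) * (ξ : ℂ) ^ 2).re = -(hh n * ξ ^ 2) := by
      rw [show -(hh n : ℂ) * (ξ : ℂ) ^ 2 = ((-(hh n * ξ ^ 2) : ℝ) : ℂ) by push_cast; ring,
        Complex.ofReal_re]
    rw [this]
    have := mul_nonneg (hh_pos n).le (sq_nonneg ξ)
    linarith
  · have hc : Continuous fun h : ℝ => Complex.exp (-(h : ℂ) * (ξ : ℂ) ^ 2) * g ξ := by fun_prop
    simpa [Function.comp_def] using (hc.tendsto 0).comp hh_tendsto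

lemma heat_of_RR {α θ t : ℝ} (h : RR (fun ξ : ℝ => Complex.exp (t * rfSymbol α θ ξ))) (x : ℝ) :
    0 ≤ heatKer α θ x t := by
  unfold heatKer heatG
  rw [Complex.re_ofReal_mul]
  exact mul_nonneg (by positivity) (h.2 x)

lemma heat_of_MM {α θ t B : ℝ} (h : MM (fun ξ : ℝ => Complex.exp (t * rfSymbol α θ ξ)) B) (x : ℝ) :
    0 ≤ heatKer α θ x t := by
  by_cases hi : Integrable (fun ξ : ℝ => Complex.exp (t * rfSymbol α θ ξ))
  · exact heat_of_RR (RR_of_MM h hi) x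
  · unfold heatKer heatG
    rw [integral_undef]
    · simp
    · intro hc
      apply hi
      have := integrable_char_mul hc (-x)
      refine this.congr (Filter.Eventually.of_forall fun ξ => ?_)
      simp only
      rw [← mul_assoc, ← Complex.exp_add]
      simp

/-- Nonnegativity of the Riesz–Feller heat kernel. -/
theorem heat_kernel_nonneg (α θ : ℝ) (hα : 0 < α) (hα2 : α ≤ 2)
    (hθ : |θ| ≤ min α (2 - α)) (h1 : (α, θ) ≠ (1, 1)) (h2 : (α, θ) ≠ (1, -1))
    (t : ℝ) (ht : 0 < t) (x : ℝ) :
    0 ≤ heatKer α θ x t := by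
  obtain ⟨ha, hb⟩ := le_min_iff.1 hθ
  rcases lt_trichotomy α 1 with h | h | h
  · exact heat_of_MM (MM_lt hα h ha ht.le) x
  · subst h
    refine heat_of_MM (MM_one (lt_of_le_of_ne ha fun hc => ?_) ht.le) x
    rcases (abs_eq zero_le_one).1 hc with hc | hc
    · exact h1 (by rw [hc])
    · exact h2 (by rw [hc])
  · rcases hα2.lt_or_eq with h' | h'
    · obtain ⟨B, hB⟩ := MM_gt h h' hb ht.le
      exact heat_of_MM hB x
    · subst h'
      have hz : θ = 0 := abs_nonpos_iff.1 (by linarith)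
      subst hz
      refine heat_of_RR ?_ x
      convert RR_gauss ht using 1
      ext ξ
      congr 1
      simp only [rfSymbol]
      rw [Real.rpow_two, sq_abs]
      simp
end

section
/- Unit total mass of the Riesz–Feller heat kernel: Let 0 < α ≤ 2, |θ| ≤ min{α, 2−α}, and (α, θ) ∉ {(1,1), (1,−1)}. Then for every t > 0, the function x ↦ G^α_θ(x,t) is integrable on ℝ and ∫_ℝ G^α_θ(x,t) dx = 1. -/
open MeasureTheory Real Filter

open Set Topology

/-- Integration by parts against an oscillating exponential. -/
lemma ibp_osc (f f' : ℝ → ℂ) (a x : ℝ)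
    (hc : ContinuousWithinAt f (Ici a) a) (hd : ∀ ξ ∈ Ioi a, HasDerivAt f (f' ξ) ξ)
    (hf : IntegrableOn f (Ioi a)) (hf' : IntegrableOn f' (Ioi a))
    (hlim : Tendsto f atTop (𝓝 0)) :
    Complex.I * x * ∫ ξ in Ioi a, Complex.exp (-Complex.I * (ξ : ℂ) * (x : ℂ)) * f ξ =
      Complex.exp (-Complex.I * (a : ℂ) * (x : ℂ)) * f a +
        ∫ ξ in Ioi a, Complex.exp (-Complex.I * (ξ : ℂ) * (x : ℂ)) * f' ξ := by
  have hn : ∀ ξ : ℝ, ‖Complex.exp (-Complex.I * (ξ : ℂ) * (x : ℂ))‖ = 1 := by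
    intro ξ; rw [Complex.norm_exp]; simp
  have hcE : Continuous (fun ξ : ℝ => Complex.exp (-Complex.I * (ξ : ℂ) * (x : ℂ))) := by fun_prop
  have hI : ∀ g : ℝ → ℂ, IntegrableOn g (Ioi a) →
      IntegrableOn (fun ξ : ℝ => Complex.exp (-Complex.I * (ξ : ℂ) * (x : ℂ)) * g ξ) (Ioi a) := by
    intro g hg
    refine Integrable.bdd_mul (c := 1) hg hcE.aestronglyMeasurable ?_
    exact Eventually.of_forall fun ξ => (hn ξ).le
  have hE : ∀ ξ : ℝ, HasDerivAt (fun ξ : ℝ => Complex.exp (-Complex.I * (ξ : ℂ) * (x : ℂ)))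
      (Complex.exp (-Complex.I * (ξ : ℂ) * (x : ℂ)) * (-Complex.I * x)) ξ := by
    intro ξ
    have h1 : HasDerivAt (fun ξ : ℝ => (-Complex.I * (ξ : ℂ) * (x : ℂ))) (-Complex.I * x) ξ := by
      have := ((Complex.ofRealCLM.hasDerivAt (x := ξ)).const_mul (-Complex.I)).mul_const (x : ℂ)
      simpa using this
    exact h1.cexp
  have key := integral_Ioi_of_hasDerivAt_of_tendsto (a := a) (m := 0)
    (f := fun ξ : ℝ => Complex.exp (-Complex.I * (ξ : ℂ) * (x : ℂ)) * f ξ)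
    (f' := fun ξ : ℝ => (-Complex.I * x) * (Complex.exp (-Complex.I * (ξ : ℂ) * (x : ℂ)) * f ξ)
      + Complex.exp (-Complex.I * (ξ : ℂ) * (x : ℂ)) * f' ξ)
    (hcE.continuousWithinAt.mul hc)
    (fun ξ hξ => by
      have := (hE ξ).mul (hd ξ hξ)
      exact this.congr_deriv (by ring))
    (((hI f hf).const_mul _).add (hI f' hf'))
    (by
      rw [tendsto_zero_iff_norm_tendsto_zero] at hlim ⊢
      simpa only [hn, norm_mul, one_mul] using hlim)
  rw [integral_add ((hI f hf).const_mul _) (hI f' hf'), integral_const_mul] at key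
  linear_combination -key

lemma rpow_mul_exp_bound (p a : ℝ) (hp : 0 < p) (ha : 0 < a) (u : ℝ) (hu : 0 < u) :
    u ^ p * exp (-a * u) ≤ (p / a) ^ p := by
  have h1 : a * u / p ≤ exp (a * u / p) := by
    have := Real.add_one_le_exp (a * u / p); linarith
  have h2 : (a * u / p) ^ p ≤ exp (a * u) := by
    calc (a * u / p) ^ p ≤ (exp (a * u / p)) ^ p :=
          Real.rpow_le_rpow (by positivity) h1 hp.le
      _ = exp (a * u) := by
          rw [← Real.exp_mul]; congr 1; field_simp
  have h3 : u ^ p = (p / a) ^ p * (a * u / p) ^ p := by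
    rw [← Real.mul_rpow (by positivity) (by positivity)]; congr 1; field_simp
  rw [h3, mul_assoc]
  have : (a * u / p) ^ p * exp (-a * u) ≤ 1 := by
    calc _ ≤ exp (a * u) * exp (-a * u) := by gcongr
      _ = 1 := by rw [← Real.exp_add]; simp
  calc _ ≤ (p / a) ^ p * 1 := by gcongr
    _ = _ := mul_one _

/-- general weight bound -/
lemma rpow_exp_bound (α a q r : ℝ) (hα : 0 < α) (ha : 0 < a) (hqr : r < q) :
    ∃ C : ℝ, 0 ≤ C ∧ ∀ ξ : ℝ, 0 < ξ → ξ ^ q * exp (-a * ξ ^ α) ≤ C * ξ ^ r := by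
  refine ⟨(((q - r) / α) / a) ^ ((q - r) / α), ?_, fun ξ hξ => ?_⟩
  · have : 0 < q - r := by linarith
    positivity
  have h := rpow_mul_exp_bound ((q - r) / α) a (div_pos (by linarith) hα) ha (ξ ^ α) (by positivity)
  rw [← Real.rpow_mul hξ.le, mul_div_cancel₀ _ hα.ne'] at h
  have e : ξ ^ q = ξ ^ (q - r) * ξ ^ r := by rw [← Real.rpow_add hξ]; congr 1; ring
  rw [e, mul_right_comm]
  gcongr

lemma half_decay (α : ℝ) (c : ℂ) (hα : 0 < α) (hα2 : α ≤ 2) (hc : 0 < c.re) :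
    ∃ C : ℝ, 0 ≤ C ∧ ∀ x : ℝ, x ≠ 0 →
      ‖Complex.I * x * (∫ ξ in Ioi (0:ℝ), Complex.exp (-Complex.I * (ξ : ℂ) * (x : ℂ)) *
        Complex.exp (-c * ((ξ ^ α : ℝ) : ℂ))) - 1‖ ≤ C * |x| ^ (-(α / 4)) := by
  set a := c.re with ha
  set φ : ℝ → ℂ := fun ξ => Complex.exp (-c * ((ξ ^ α : ℝ) : ℂ)) with hφ
  set φ1 : ℝ → ℂ := fun ξ => (-c * α) * (((ξ ^ (α - 1) : ℝ) : ℂ) * φ ξ) with hφ1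
  set φ2 : ℝ → ℂ := fun ξ => (-c * α) * ((((α - 1) * ξ ^ (α - 2) : ℝ) : ℂ) * φ ξ
    + ((ξ ^ (α - 1) : ℝ) : ℂ) * φ1 ξ) with hφ2
  have nφ : ∀ ξ, ‖φ ξ‖ = exp (-a * ξ ^ α) := by
    intro ξ; simp [hφ, Complex.norm_exp, ha]
  have hr : ∀ q ξ : ℝ, 0 < ξ → HasDerivAt (fun ξ : ℝ => ((ξ ^ q : ℝ) : ℂ))
      ((q * ξ ^ (q - 1) : ℝ) : ℂ) ξ := fun q ξ hξ =>
    (Real.hasDerivAt_rpow_const (Or.inl hξ.ne')).ofReal_comp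
  have d1 : ∀ ξ : ℝ, 0 < ξ → HasDerivAt φ (φ1 ξ) ξ := by
    intro ξ hξ
    have := ((hr α ξ hξ).const_mul (-c)).cexp
    convert this using 1
    simp only [hφ1, hφ]; push_cast; ring
  have d2 : ∀ ξ : ℝ, 0 < ξ → HasDerivAt φ1 (φ2 ξ) ξ := by
    intro ξ hξ
    have := (((hr (α - 1) ξ hξ).mul (d1 ξ hξ))).const_mul (-c * α)
    rw [show α - 1 - 1 = α - 2 by ring] at this
    exact this
  have cφ : Continuous φ := by
    have : Continuous (fun ξ : ℝ => ξ ^ α) := Real.continuous_rpow_const hα.le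
    fun_prop
  have n1 : ∀ ξ : ℝ, 0 < ξ → ‖φ1 ξ‖ = ‖c‖ * α * (ξ ^ (α - 1) * exp (-a * ξ ^ α)) := by
    intro ξ hξ
    have : 0 ≤ ξ ^ (α - 1) := by positivity
    simp only [hφ1, norm_mul, norm_neg, nφ, Complex.norm_real, Real.norm_eq_abs, abs_of_pos hα,
      abs_of_nonneg this]
  have n2 : ∀ ξ : ℝ, 0 < ξ → ‖φ2 ξ‖ ≤ ‖c‖ * α * (|α - 1| * (ξ ^ (α - 2) * exp (-a * ξ ^ α))
      + ‖c‖ * α * (ξ ^ (2 * α - 2) * exp (-a * ξ ^ α))) := by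
    intro ξ hξ
    have h0 : 0 ≤ ξ ^ (α - 1) := by positivity
    have h1 : 0 ≤ ξ ^ (α - 2) := by positivity
    have e : ξ ^ (2 * α - 2) = ξ ^ (α - 1) * ξ ^ (α - 1) := by
      rw [← Real.rpow_add hξ]; congr 1; ring
    simp only [hφ2]
    rw [norm_mul, norm_mul, norm_neg, Complex.norm_real, Real.norm_eq_abs, abs_of_pos hα]
    gcongr
    refine (norm_add_le _ _).trans (le_of_eq ?_)
    rw [norm_mul, norm_mul, n1 ξ hξ, nφ, Complex.norm_real, Complex.norm_real, Real.norm_eq_abs,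
      Real.norm_eq_abs, abs_mul, abs_of_nonneg h0, abs_of_nonneg h1, e]
    ring
  obtain ⟨C0, hC0, b0⟩ := rpow_exp_bound α a 0 (-(α/4)) hα hc (by linarith)
  obtain ⟨C1, hC1, b1⟩ := rpow_exp_bound α a (α - 1) (α / 4 - 1) hα hc (by linarith)
  obtain ⟨C2, hC2, b2⟩ := rpow_exp_bound α a (α - 2) (α / 4 - 2) hα hc (by linarith)
  obtain ⟨C3, hC3, b3⟩ := rpow_exp_bound α a (2 * α - 2) (α / 4 - 2) hα hc (by linarith)
  set A := ‖c‖ * α * C1 with hA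
  set B := ‖c‖ * α * (|α - 1| * C2 + ‖c‖ * α * C3) with hB
  have hA0 : 0 ≤ A := by positivity
  have hB0 : 0 ≤ B := by positivity
  have B1 : ∀ ξ : ℝ, 0 < ξ → ‖φ1 ξ‖ ≤ A * ξ ^ (α / 4 - 1) := by
    intro ξ hξ
    rw [n1 ξ hξ, hA, mul_assoc (‖c‖ * α)]
    have := b1 ξ hξ
    gcongr
  have B2 : ∀ ξ : ℝ, 0 < ξ → ‖φ2 ξ‖ ≤ B * ξ ^ (α / 4 - 2) := by
    intro ξ hξ
    refine (n2 ξ hξ).trans ?_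
    have h2 := b2 ξ hξ
    have h3 := b3 ξ hξ
    calc _ ≤ ‖c‖ * α * (|α - 1| * (C2 * ξ ^ (α / 4 - 2)) + ‖c‖ * α * (C3 * ξ ^ (α / 4 - 2))) := by
          gcongr
      _ = _ := by rw [hB]; ring
  have m1 : ContinuousOn φ1 (Ioi 0) := fun ξ hξ => (d2 ξ hξ).continuousAt.continuousWithinAt
  have m2 : ContinuousOn φ2 (Ioi 0) := by
    have hp : ∀ q : ℝ, ContinuousOn (fun ξ : ℝ => ((ξ ^ q : ℝ) : ℂ)) (Ioi 0) := fun q ξ hξ =>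
      (hr q ξ hξ).continuousAt.continuousWithinAt
    have hq : ContinuousOn (fun ξ : ℝ => (((α - 1) * ξ ^ (α - 2) : ℝ) : ℂ)) (Ioi 0) := by
      have := (hp (α - 2)).const_smul ((α - 1 : ℝ) : ℂ)
      refine this.congr fun ξ _ => ?_
      simp
    exact continuousOn_const.mul ((hq.mul cφ.continuousOn).add ((hp _).mul m1))
  have iφ : IntegrableOn φ (Ioi 0) := by
    have := integrableOn_rpow_mul_exp_neg_mul_rpow (p := α) (s := 0) (b := a) (by norm_num) hα hc
    refine Integrable.mono' this cφ.aestronglyMeasurable (Eventually.of_forall fun ξ => ?_)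
    simp [nφ]
  have i1 : IntegrableOn φ1 (Ioi 0) := by
    have := (integrableOn_rpow_mul_exp_neg_mul_rpow (p := α) (s := α - 1) (b := a)
      (by linarith) hα hc).const_mul (‖c‖ * α)
    refine Integrable.mono' this (m1.aestronglyMeasurable measurableSet_Ioi) ?_
    filter_upwards [ae_restrict_mem measurableSet_Ioi] with ξ hξ
    exact (n1 ξ hξ).le
  have i2 : ∀ δ : ℝ, 0 < δ → IntegrableOn φ2 (Ioi δ) := by
    intro δ hδ
    have := (integrableOn_Ioi_rpow_of_lt (a := α / 4 - 2) (by linarith) hδ).const_mul B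
    refine Integrable.mono' this
      ((m2.mono (Ioi_subset_Ioi hδ.le)).aestronglyMeasurable measurableSet_Ioi) ?_
    filter_upwards [ae_restrict_mem measurableSet_Ioi] with ξ hξ
    exact B2 ξ (hδ.trans hξ)
  have l0 : Tendsto φ atTop (𝓝 0) := by
    have := (tendsto_rpow_neg_atTop (y := α / 4) (by linarith)).const_mul C0
    rw [mul_zero] at this
    refine squeeze_zero_norm' ?_ this
    filter_upwards [eventually_gt_atTop 0] with ξ hξ
    have := b0 ξ hξ
    simpa [nφ] using this
  have l1 : Tendsto φ1 atTop (𝓝 0) := by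
    have := (tendsto_rpow_neg_atTop (y := 1 - α / 4) (by linarith)).const_mul A
    rw [mul_zero] at this
    refine squeeze_zero_norm' ?_ this
    filter_upwards [eventually_gt_atTop 0] with ξ hξ
    have := B1 ξ hξ
    rwa [show -(1 - α / 4) = α / 4 - 1 by ring]
  have hβ : 0 < 1 - α / 4 := by linarith
  refine ⟨A / (α / 4) + (A + B / (1 - α / 4)), by positivity, fun x hx => ?_⟩
  have hn : ∀ ξ : ℝ, ‖Complex.exp (-Complex.I * (ξ : ℂ) * (x : ℂ))‖ = 1 := by
    intro ξ; rw [Complex.norm_exp]; simp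
  have hcE : Continuous (fun ξ : ℝ => Complex.exp (-Complex.I * (ξ : ℂ) * (x : ℂ))) := by fun_prop
  have I1 := ibp_osc φ φ1 0 x cφ.continuousWithinAt d1 iφ i1 l0
  rw [I1]
  have hφ0 : φ 0 = 1 := by simp [hφ, Real.zero_rpow hα.ne']
  rw [hφ0]
  simp only [Complex.ofReal_zero, mul_zero, zero_mul, Complex.exp_zero, mul_one, add_sub_cancel_left]
  have hax : 0 < |x| := abs_pos.2 hx
  set δ := |x|⁻¹ with hδ
  have hδ0 : 0 < δ := by positivity
  have I2 := ibp_osc φ1 φ2 δ x (d2 δ hδ0).continuousAt.continuousWithinAt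
    (fun ξ hξ => d2 ξ (hδ0.trans hξ)) (i1.mono_set (Ioi_subset_Ioi hδ0.le)) (i2 δ hδ0) l1
  have iE : IntegrableOn (fun ξ : ℝ => Complex.exp (-Complex.I * (ξ : ℂ) * (x : ℂ)) * φ1 ξ)
      (Ioi 0) := Integrable.bdd_mul (c := 1) i1 hcE.aestronglyMeasurable
        (Eventually.of_forall fun ξ => (hn ξ).le)
  rw [← Ioc_union_Ioi_eq_Ioi hδ0.le, setIntegral_union (Ioc_disjoint_Ioi le_rfl) measurableSet_Ioi
    (iE.mono_set Ioc_subset_Ioi_self) (iE.mono_set (Ioi_subset_Ioi hδ0.le))]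
  have eδ : ∀ q : ℝ, δ ^ q = |x| ^ (-q) := by
    intro q; rw [hδ, Real.inv_rpow hax.le, Real.rpow_neg hax.le]
  have J1 : ‖∫ ξ in Ioc 0 δ, Complex.exp (-Complex.I * (ξ : ℂ) * (x : ℂ)) * φ1 ξ‖ ≤
      A / (α / 4) * |x| ^ (-(α / 4)) := by
    have hi : IntegrableOn (fun ξ : ℝ => ξ ^ (α / 4 - 1)) (Ioc 0 δ) :=
      (intervalIntegrable_iff_integrableOn_Ioc_of_le hδ0.le).1
        (intervalIntegral.intervalIntegrable_rpow' (by linarith))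
    have := norm_integral_le_of_norm_le (hi.const_mul A)
      (f := fun ξ : ℝ => Complex.exp (-Complex.I * (ξ : ℂ) * (x : ℂ)) * φ1 ξ) (by
        filter_upwards [ae_restrict_mem measurableSet_Ioc] with ξ hξ
        rw [norm_mul, hn, one_mul]
        exact B1 ξ hξ.1)
    refine this.trans (le_of_eq ?_)
    rw [integral_const_mul, ← intervalIntegral.integral_of_le hδ0.le,
      integral_rpow (Or.inl (by linarith)), sub_add_cancel, Real.zero_rpow (by positivity), eδ]
    ring
  have J2 : ‖∫ ξ in Ioi δ, Complex.exp (-Complex.I * (ξ : ℂ) * (x : ℂ)) * φ1 ξ‖ ≤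
      (A + B / (1 - α / 4)) * |x| ^ (-(α / 4)) := by
    have K : ‖∫ ξ in Ioi δ, Complex.exp (-Complex.I * (ξ : ℂ) * (x : ℂ)) * φ2 ξ‖ ≤
        B / (1 - α / 4) * δ ^ (α / 4 - 1) := by
      have := norm_integral_le_of_norm_le
        ((integrableOn_Ioi_rpow_of_lt (a := α / 4 - 2) (by linarith) hδ0).const_mul B)
        (f := fun ξ : ℝ => Complex.exp (-Complex.I * (ξ : ℂ) * (x : ℂ)) * φ2 ξ) (by
          filter_upwards [ae_restrict_mem measurableSet_Ioi] with ξ hξ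
          rw [norm_mul, hn, one_mul]
          exact B2 ξ (hδ0.trans hξ))
      refine this.trans (le_of_eq ?_)
      rw [integral_const_mul, integral_Ioi_rpow_of_lt (by linarith) hδ0,
        show α / 4 - 2 + 1 = -(1 - α / 4) by ring, show α / 4 - 1 = -(1 - α / 4) by ring,
        neg_div_neg_eq]
      ring
    have h3 := congrArg norm I2
    rw [norm_mul, norm_mul, Complex.norm_I, one_mul, Complex.norm_real, Real.norm_eq_abs] at h3
    have h4 : |x| * ‖∫ ξ in Ioi δ, Complex.exp (-Complex.I * (ξ : ℂ) * (x : ℂ)) * φ1 ξ‖ ≤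
        (A + B / (1 - α / 4)) * δ ^ (α / 4 - 1) := by
      rw [h3]
      refine (norm_add_le _ _).trans ?_
      rw [norm_mul, hn, one_mul]
      have := B1 δ hδ0
      linarith
    have e : δ ^ (α / 4 - 1) = |x| * |x| ^ (-(α / 4)) := by
      rw [eδ, show -(α / 4 - 1) = 1 + -(α / 4) by ring, Real.rpow_add hax, Real.rpow_one]
    rw [e] at h4
    refine le_of_mul_le_mul_left ?_ hax
    linarith
  refine (norm_add_le _ _).trans ?_
  linarith

lemma cos_pos_of_params (α θ : ℝ) (hθ : |θ| ≤ min α (2 - α)) (h1 : (α, θ) ≠ (1, 1))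
    (h2 : (α, θ) ≠ (1, -1)) : 0 < Real.cos (θ * (π / 2)) := by
  obtain ⟨ha, hb⟩ := le_min_iff.1 hθ
  have hlt : |θ| < 1 := by
    by_contra hcon
    push Not at hcon
    have e1 : α = 1 := by linarith
    have e2 : |θ| = 1 := by linarith
    rcases eq_or_eq_neg_of_abs_eq e2 with h | h
    · exact h1 (by rw [e1, h])
    · exact h2 (by rw [e1, h])
  rw [abs_lt] at hlt
  have := Real.pi_pos
  apply Real.cos_pos_of_mem_Ioo
  constructor <;> nlinarith [hlt.1, hlt.2]

lemma re_param (θ t : ℝ) :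
    ((t : ℂ) * Complex.exp (Complex.I * (θ : ℂ) * ((π / 2 : ℝ) : ℂ))).re =
      t * Real.cos (θ * (π / 2)) := by
  have : Complex.I * (θ : ℂ) * ((π / 2 : ℝ) : ℂ) = ((θ * (π / 2) : ℝ) : ℂ) * Complex.I := by
    push_cast; ring
  rw [this, Complex.re_ofReal_mul, Complex.exp_ofReal_mul_I_re]

lemma symb_pos (α θ t ξ : ℝ) (hξ : 0 < ξ) :
    (t : ℂ) * rfSymbol α θ ξ =
      -((t : ℂ) * Complex.exp (Complex.I * (θ : ℂ) * ((π / 2 : ℝ) : ℂ))) * ((ξ ^ α : ℝ) : ℂ) := by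
  rw [rfSymbol, Real.sign_of_pos hξ, abs_of_pos hξ]
  simp only [Complex.ofReal_one, mul_one]
  ring

lemma symb_neg (α θ t ξ : ℝ) (hξ : 0 < ξ) :
    (t : ℂ) * rfSymbol α θ (-ξ) =
      -((t : ℂ) * Complex.exp (Complex.I * ((-θ : ℝ) : ℂ) * ((π / 2 : ℝ) : ℂ))) *
        ((ξ ^ α : ℝ) : ℂ) := by
  rw [rfSymbol, Real.sign_of_neg (by linarith), abs_neg, abs_of_pos hξ]
  have : Complex.I * ((-1 : ℝ) : ℂ) * (θ : ℂ) * ((π / 2 : ℝ) : ℂ) =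
    Complex.I * ((-θ : ℝ) : ℂ) * ((π / 2 : ℝ) : ℂ) := by push_cast; ring
  rw [this]
  ring

lemma norm_symb (α θ t ξ : ℝ) (hα : 0 < α) :
    ‖Complex.exp ((t : ℂ) * rfSymbol α θ ξ)‖ =
      exp (-(t * Real.cos (θ * (π / 2))) * |ξ| ^ α) := by
  rw [Complex.norm_exp]
  congr 1
  rcases lt_trichotomy ξ 0 with h | h | h
  · obtain ⟨η, rfl⟩ : ∃ η, ξ = -η := ⟨-ξ, by ring⟩
    have hη : 0 < η := by linarith
    rw [symb_neg _ _ _ _ hη, Complex.re_mul_ofReal, Complex.neg_re, re_param, abs_neg,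
      abs_of_pos hη, neg_mul θ, Real.cos_neg]
  · subst h
    simp [rfSymbol, Real.zero_rpow hα.ne']
  · rw [symb_pos _ _ _ _ h, Complex.re_mul_ofReal, Complex.neg_re, re_param, abs_of_pos h]

lemma cont_symb (α θ t : ℝ) (hα : 0 < α) :
    Continuous (fun ξ : ℝ => Complex.exp ((t : ℂ) * rfSymbol α θ ξ)) := by
  have hp : ∀ c : ℂ, Continuous (fun ξ : ℝ => Complex.exp (-c * ((|ξ| ^ α : ℝ) : ℂ))) := by
    intro c
    have : Continuous (fun ξ : ℝ => |ξ| ^ α) := (Real.continuous_rpow_const hα.le).comp continuous_abs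
    fun_prop
  have : (fun ξ : ℝ => Complex.exp ((t : ℂ) * rfSymbol α θ ξ)) = fun ξ : ℝ =>
      if ξ ≤ 0 then
        Complex.exp (-((t : ℂ) * Complex.exp (Complex.I * ((-θ : ℝ) : ℂ) * ((π / 2 : ℝ) : ℂ))) *
          ((|ξ| ^ α : ℝ) : ℂ))
      else Complex.exp (-((t : ℂ) * Complex.exp (Complex.I * (θ : ℂ) * ((π / 2 : ℝ) : ℂ))) *
          ((|ξ| ^ α : ℝ) : ℂ)) := by
    funext ξ
    split_ifs with h
    · rcases h.eq_or_lt with h | h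
      · subst h
        simp [rfSymbol, Real.zero_rpow hα.ne']
      · obtain ⟨η, rfl⟩ : ∃ η, ξ = -η := ⟨-ξ, by ring⟩
        have hη : 0 < η := by linarith
        rw [symb_neg _ _ _ _ hη, abs_neg, abs_of_pos hη]
    · push Not at h
      rw [symb_pos _ _ _ _ h, abs_of_pos h]
  rw [this]
  refine Continuous.if_le (hp _) (hp _) continuous_id continuous_const ?_
  intro ξ h
  have : ξ = 0 := h
  subst this
  simp [Real.zero_rpow hα.ne']

lemma integrable_symb (α θ t : ℝ) (hα : 0 < α) (hb : 0 < t * Real.cos (θ * (π / 2))) :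
    Integrable (fun ξ : ℝ => Complex.exp ((t : ℂ) * rfSymbol α θ ξ)) := by
  set b := t * Real.cos (θ * (π / 2)) with hbd
  have h0 : IntegrableOn (fun ξ : ℝ => exp (-b * |ξ| ^ α)) (Ioi 0) := by
    have := integrableOn_rpow_mul_exp_neg_mul_rpow (p := α) (s := 0) (b := b) (by norm_num) hα hb
    refine this.congr_fun (fun ξ hξ => ?_) measurableSet_Ioi
    have hξ' : 0 < ξ := hξ
    simp [abs_of_pos hξ']
  have h1 : IntegrableOn (fun ξ : ℝ => exp (-b * |ξ| ^ α)) (Iio 0) := by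
    have := (Measure.measurePreserving_neg (volume : Measure ℝ)).integrableOn_comp_preimage
      (Homeomorph.neg ℝ).measurableEmbedding (f := fun ξ : ℝ => exp (-b * |ξ| ^ α)) (s := Iio 0)
    rw [← this]
    simpa [Function.comp_def] using h0
  have h2 : Integrable (fun ξ : ℝ => exp (-b * |ξ| ^ α)) := by
    rw [← integrableOn_univ, ← Iic_union_Ioi (a := (0:ℝ))]
    exact ((integrableOn_Iic_iff_integrableOn_Iio (by simp)).2 h1).union h0
  refine h2.mono' (cont_symb α θ t hα).aestronglyMeasurable (Eventually.of_forall fun ξ => ?_)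
  rw [norm_symb _ _ _ _ hα]

lemma transform_integrable (α θ t : ℝ) (hα : 0 < α) (hα2 : α ≤ 2)
    (hb : 0 < t * Real.cos (θ * (π / 2))) :
    Integrable (fun x : ℝ => ∫ ξ : ℝ, Complex.exp (-Complex.I * (ξ : ℂ) * (x : ℂ)) *
      Complex.exp ((t : ℂ) * rfSymbol α θ ξ)) := by
  have iΦ := integrable_symb α θ t hα hb
  have cΦ := cont_symb α θ t hα
  have hn : ∀ ξ x : ℝ, ‖Complex.exp (-Complex.I * (ξ : ℂ) * (x : ℂ))‖ = 1 := by
    intro ξ x; rw [Complex.norm_exp]; simp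
  have hcE : ∀ x : ℝ, Continuous (fun ξ : ℝ => Complex.exp (-Complex.I * (ξ : ℂ) * (x : ℂ))) := by
    intro x; fun_prop
  have iE : ∀ x : ℝ, Integrable (fun ξ : ℝ => Complex.exp (-Complex.I * (ξ : ℂ) * (x : ℂ)) *
      Complex.exp ((t : ℂ) * rfSymbol α θ ξ)) := fun x =>
    Integrable.bdd_mul (c := 1) iΦ (hcE x).aestronglyMeasurable
      (Eventually.of_forall fun ξ => (hn ξ x).le)
  have hcont : Continuous (fun x : ℝ => ∫ ξ : ℝ, Complex.exp (-Complex.I * (ξ : ℂ) * (x : ℂ)) *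
      Complex.exp ((t : ℂ) * rfSymbol α θ ξ)) := by
    refine continuous_of_dominated (bound := fun ξ => ‖Complex.exp ((t : ℂ) * rfSymbol α θ ξ)‖)
      (fun x => (iE x).aestronglyMeasurable) (fun x => Eventually.of_forall fun ξ => ?_)
      iΦ.norm (Eventually.of_forall fun ξ => ?_)
    · rw [norm_mul, hn, one_mul]
    · fun_prop
  set M := ∫ ξ : ℝ, ‖Complex.exp ((t : ℂ) * rfSymbol α θ ξ)‖ with hM
  have hM0 : 0 ≤ M := integral_nonneg fun _ => norm_nonneg _
  have hbd : ∀ x : ℝ, ‖∫ ξ : ℝ, Complex.exp (-Complex.I * (ξ : ℂ) * (x : ℂ)) *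
      Complex.exp ((t : ℂ) * rfSymbol α θ ξ)‖ ≤ M := by
    intro x
    refine (norm_integral_le_integral_norm _).trans (le_of_eq ?_)
    simp_rw [norm_mul, hn, one_mul]
    exact hM.symm
  obtain ⟨C, hC, dC⟩ := half_decay α ((t : ℂ) * Complex.exp (Complex.I * (θ : ℂ) * ((π / 2 : ℝ) : ℂ)))
    hα hα2 (by rw [re_param]; exact hb)
  obtain ⟨D, hD, dD⟩ := half_decay α
    ((t : ℂ) * Complex.exp (Complex.I * ((-θ : ℝ) : ℂ) * ((π / 2 : ℝ) : ℂ)))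
    hα hα2 (by rw [re_param, neg_mul, Real.cos_neg]; exact hb)
  have hdec : ∀ x : ℝ, x ≠ 0 → |x| * ‖∫ ξ : ℝ, Complex.exp (-Complex.I * (ξ : ℂ) * (x : ℂ)) *
      Complex.exp ((t : ℂ) * rfSymbol α θ ξ)‖ ≤ (C + D) * |x| ^ (-(α / 4)) := by
    intro x hx
    have h1 := dC x hx
    have h2 := dD (-x) (neg_ne_zero.2 hx)
    rw [abs_neg] at h2
    have e1 : ∫ ξ in Ioi (0:ℝ), Complex.exp (-Complex.I * (ξ : ℂ) * (x : ℂ)) *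
        Complex.exp ((t : ℂ) * rfSymbol α θ ξ) =
        ∫ ξ in Ioi (0:ℝ), Complex.exp (-Complex.I * (ξ : ℂ) * (x : ℂ)) *
        Complex.exp (-((t : ℂ) * Complex.exp (Complex.I * (θ : ℂ) * ((π / 2 : ℝ) : ℂ))) *
          ((ξ ^ α : ℝ) : ℂ)) :=
      setIntegral_congr_fun measurableSet_Ioi fun ξ hξ => by
        simp only [symb_pos α θ t ξ hξ]
    have e2 : ∫ ξ in Iic (0:ℝ), Complex.exp (-Complex.I * (ξ : ℂ) * (x : ℂ)) *
        Complex.exp ((t : ℂ) * rfSymbol α θ ξ) =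
        ∫ ξ in Ioi (0:ℝ), Complex.exp (-Complex.I * (ξ : ℂ) * ((-x : ℝ) : ℂ)) *
        Complex.exp (-((t : ℂ) * Complex.exp (Complex.I * ((-θ : ℝ) : ℂ) * ((π / 2 : ℝ) : ℂ))) *
          ((ξ ^ α : ℝ) : ℂ)) := by
      have := integral_comp_neg_Iic (0:ℝ) (fun ξ : ℝ =>
        Complex.exp (-Complex.I * ((-ξ : ℝ) : ℂ) * (x : ℂ)) *
        Complex.exp ((t : ℂ) * rfSymbol α θ (-ξ)))
      simp only [neg_neg, neg_zero] at this
      rw [this]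
      refine setIntegral_congr_fun measurableSet_Ioi fun ξ hξ => ?_
      simp only [symb_neg α θ t ξ hξ]
      congr 2
      push_cast; ring
    rw [← intervalIntegral.integral_Iic_add_Ioi (iE x).integrableOn (iE x).integrableOn (b := 0), e1, e2]
    set P := ∫ ξ in Ioi (0:ℝ), Complex.exp (-Complex.I * (ξ : ℂ) * (x : ℂ)) *
        Complex.exp (-((t : ℂ) * Complex.exp (Complex.I * (θ : ℂ) * ((π / 2 : ℝ) : ℂ))) *
          ((ξ ^ α : ℝ) : ℂ))
    set Q := ∫ ξ in Ioi (0:ℝ), Complex.exp (-Complex.I * (ξ : ℂ) * ((-x : ℝ) : ℂ)) *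
        Complex.exp (-((t : ℂ) * Complex.exp (Complex.I * ((-θ : ℝ) : ℂ) * ((π / 2 : ℝ) : ℂ))) *
          ((ξ ^ α : ℝ) : ℂ))
    have e3 : |x| * ‖Q + P‖ = ‖(Complex.I * x * P - 1) - (Complex.I * ((-x : ℝ) : ℂ) * Q - 1)‖ := by
      have : (Complex.I * x * P - 1) - (Complex.I * ((-x : ℝ) : ℂ) * Q - 1) =
        Complex.I * ((x : ℂ) * (Q + P)) := by push_cast; ring
      rw [this, norm_mul, norm_mul, Complex.norm_I, one_mul, Complex.norm_real, Real.norm_eq_abs]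
    rw [e3]
    refine (norm_sub_le _ _).trans ?_
    linarith
  have hJ := (integrable_one_add_norm (E := ℝ) (μ := volume) (r := 1 + α / 4)
    (by simp; linarith)).const_mul ((M + (C + D)) * 2 ^ (1 + α / 4))
  refine hJ.mono' hcont.aestronglyMeasurable (Eventually.of_forall fun x => ?_)
  rw [mul_assoc]
  have hpos : 0 < 1 + ‖x‖ := by positivity
  have e4 : (2:ℝ) ^ (1 + α / 4) * (1 + ‖x‖) ^ (-(1 + α / 4)) =
      (2 / (1 + ‖x‖)) ^ (1 + α / 4) := by
    rw [Real.div_rpow (by norm_num) hpos.le, Real.rpow_neg hpos.le, ← div_eq_mul_inv]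
  rw [e4, Real.norm_eq_abs x]
  have hq : 0 ≤ 1 + α / 4 := by linarith
  rcases le_or_gt |x| 1 with h | h
  · have h5 : (1:ℝ) ≤ (2 / (1 + |x|)) ^ (1 + α / 4) := by
      apply Real.one_le_rpow _ hq
      rw [le_div_iff₀ (by positivity)]; linarith
    calc _ ≤ M := hbd x
      _ ≤ (M + (C + D)) * 1 := by linarith
      _ ≤ _ := by gcongr
  · have hx0 : 0 < |x| := by linarith
    have h5 : |x| ^ (-(1 + α / 4)) ≤ (2 / (1 + |x|)) ^ (1 + α / 4) := by
      rw [Real.rpow_neg hx0.le, ← Real.inv_rpow hx0.le]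
      apply Real.rpow_le_rpow (by positivity) _ hq
      rw [inv_eq_one_div, div_le_div_iff₀ hx0 (by positivity)]; linarith
    have h6 := hdec x (abs_pos.1 hx0)
    have h7 : ‖∫ ξ : ℝ, Complex.exp (-Complex.I * (ξ : ℂ) * (x : ℂ)) *
      Complex.exp ((t : ℂ) * rfSymbol α θ ξ)‖ ≤ (C + D) * |x| ^ (-(1 + α / 4)) := by
      refine le_of_mul_le_mul_left (h6.trans (le_of_eq ?_)) hx0
      have : |x| ^ (-(α / 4)) = |x| * |x| ^ (-(1 + α / 4)) := by
        nth_rewrite 2 [← Real.rpow_one |x|]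
        rw [← Real.rpow_add hx0]; congr 1; ring
      rw [this]; ring
    calc _ ≤ (C + D) * |x| ^ (-(1 + α / 4)) := h7
      _ ≤ (M + (C + D)) * |x| ^ (-(1 + α / 4)) := by
          apply mul_le_mul_of_nonneg_right (by linarith) (by positivity)
      _ ≤ _ := by gcongr

open scoped FourierTransform in
lemma transform_integral (α θ t : ℝ) (hα : 0 < α) (hα2 : α ≤ 2)
    (hb : 0 < t * Real.cos (θ * (π / 2))) :
    ∫ x : ℝ, ∫ ξ : ℝ, Complex.exp (-Complex.I * (ξ : ℂ) * (x : ℂ)) *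
      Complex.exp ((t : ℂ) * rfSymbol α θ ξ) = ((2 * π : ℝ) : ℂ) := by
  have iH := transform_integrable α θ t hα hα2 hb
  set Φ : ℝ → ℂ := fun ξ => Complex.exp ((t : ℂ) * rfSymbol α θ ξ) with hΦ
  set H : ℝ → ℂ := fun x : ℝ => ∫ ξ : ℝ, Complex.exp (-Complex.I * (ξ : ℂ) * (x : ℂ)) * Φ ξ with hH
  have hF : 𝓕 Φ = fun w : ℝ => H ((2 * π) * w) := by
    funext w
    rw [Real.fourier_real_eq_integral_exp_smul, hH]
    refine integral_congr_ae (Eventually.of_forall fun ξ => ?_)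
    simp only [smul_eq_mul]
    congr 2
    push_cast; ring
  have h2π : (2 * π) ≠ 0 := by positivity
  have iF : Integrable (𝓕 Φ) := by
    rw [hF]; exact iH.comp_mul_left' h2π
  have inv := congrFun ((cont_symb α θ t hα).fourierInv_fourier_eq
    (integrable_symb α θ t hα hb) iF) 0
  rw [Real.fourierInv_eq'] at inv
  have e : ∫ w : ℝ, 𝓕 Φ w = 1 := by
    have h0 : Φ 0 = 1 := by simp [hΦ, rfSymbol, Real.zero_rpow hα.ne']
    refine Eq.trans ?_ (inv.trans h0)
    simp [hΦ]
  rw [hF, Measure.integral_comp_mul_left H (2 * π), abs_of_pos (by positivity)] at e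
  rw [inv_smul_eq_iff₀ h2π] at e
  change ∫ x, H x = _
  rw [e]
  simp

/-- Integrability and unit total mass of the Riesz–Feller heat kernel. -/
theorem heat_kernel_total_mass_one (α θ : ℝ) (hα : 0 < α) (hα2 : α ≤ 2)
    (hθ : |θ| ≤ min α (2 - α)) (h1 : (α, θ) ≠ (1, 1)) (h2 : (α, θ) ≠ (1, -1))
    (t : ℝ) (ht : 0 < t) :
    Integrable (fun x : ℝ => heatKer α θ x t) ∧ ∫ x : ℝ, heatKer α θ x t = 1 := by
  have hb : 0 < t * Real.cos (θ * (π / 2)) := mul_pos ht (cos_pos_of_params α θ hθ h1 h2)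
  have hI : Integrable (fun x : ℝ => heatG α θ x t) :=
    (transform_integrable α θ t hα hα2 hb).const_mul _
  have hV : ∫ x : ℝ, heatG α θ x t = 1 := by
    simp only [heatG]
    rw [integral_const_mul, transform_integral α θ t hα hα2 hb, ← Complex.ofReal_mul,
      one_div, inv_mul_cancel₀ (by positivity), Complex.ofReal_one]
  refine ⟨hI.re, ?_⟩
  have := integral_re hI
  rw [hV] at this
  simpa [heatKer] using this
end

section
/- Fourier transform of the heat kernel: Let 0 < α ≤ 2, |θ| ≤ min{α, 2−α}, and (α, θ) ∉ {(1,1), (1,−1)}. Then for every t > 0, G^α_θ(·,t) ∈ L¹(ℝ) and for every ξ ∈ ℝ, ∫_ℝ e^{iξx}·G^α_θ(x,t) dx = e^{t·ψ^α_θ(ξ)}. -/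
open MeasureTheory Real Filter

lemma secondDiff_bound (φ f1 f2 : ℝ → ℂ) (C β : ℝ) (hC : 0 ≤ C) (hβ1 : β < 1)
    (hd1 : ∀ y, 0 < y → HasDerivAt φ (f1 y) y) (hd2 : ∀ y, 0 < y → HasDerivAt f1 (f2 y) y)
    (hb : ∀ y, 0 < y → ‖f2 y‖ ≤ C * y ^ (β - 2)) (r h : ℝ) (hr : 0 < r) (hh : 0 < h) :
    ‖φ (r + 2 * h) - 2 * φ (r + h) + φ r‖ ≤ C * r ^ (β - 2) * h ^ 2 := by
  set M := C * r ^ (β - 2) with hM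
  have hbM : ∀ y ∈ Set.Ici r, ‖f2 y‖ ≤ M := by
    intro y hy
    have hy' : r ≤ y := hy
    refine (hb y (by linarith)).trans ?_
    exact mul_le_mul_of_nonneg_left (Real.rpow_le_rpow_of_nonpos hr hy' (by linarith)) hC
  have hf1 : ∀ y ∈ Set.Ici r, ‖f1 (y + h) - f1 y‖ ≤ M * h := by
    intro y hy
    have hy' : r ≤ y := hy
    have := Convex.norm_image_sub_le_of_norm_hasDerivWithin_le (f := f1) (f' := f2)
      (s := Set.Ici r) (C := M) (x := y) (y := y + h)
      (fun z hz => (hd2 z (lt_of_lt_of_le hr hz)).hasDerivWithinAt) hbM (convex_Ici r) hy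
      (by simp only [Set.mem_Ici]; linarith)
    simpa [abs_of_pos hh] using this
  have := Convex.norm_image_sub_le_of_norm_hasDerivWithin_le
      (f := fun y => φ (y + h) - φ y) (f' := fun y => f1 (y + h) - f1 y)
      (s := Set.Ici r) (C := M * h) (x := r) (y := r + h)
      (fun z hz => by
        have hz' : r ≤ z := hz
        have h1 := (hd1 (z + h) (by linarith)).comp_add_const z h
        exact (h1.sub (hd1 z (by linarith))).hasDerivWithinAt) hf1 (convex_Ici r) (by simp)
      (by simp only [Set.mem_Ici]; linarith)
  have e : φ (r + 2 * h) - 2 * φ (r + h) + φ r = φ (r + h + h) - φ (r + h) - (φ (r + h) - φ r) := by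
    rw [show r + 2 * h = r + h + h by ring]; ring
  rw [e]
  refine this.trans (le_of_eq ?_)
  rw [show r + h - r = h by ring, Real.norm_eq_abs, abs_of_pos hh]; ring

lemma kernel_lower (β u v : ℝ) (hβ0 : 0 < β) (hβ1 : β < 1) (hu : 0 ≤ u) (_hv : 0 < v)
    (h : (1 + u) / 4 ≤ v) :
    v ^ (β - 2) ≤ 16 * (1 + u) ^ (-(2 - β)) := by
  have h1 : v ^ (β - 2) ≤ ((1 + u) / 4) ^ (β - 2) :=
    Real.rpow_le_rpow_of_nonpos (by linarith) h (by linarith)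
  refine h1.trans ?_
  rw [Real.div_rpow (by linarith) (by norm_num), div_eq_mul_inv, ← Real.rpow_neg (by norm_num),
    mul_comm, neg_sub, neg_sub]
  refine mul_le_mul_of_nonneg_right ?_ (Real.rpow_nonneg (by linarith) _)
  calc (4:ℝ) ^ (2 - β) ≤ 4 ^ (2:ℝ) := Real.rpow_le_rpow_of_exponent_le (by norm_num) (by linarith)
    _ = 16 := by norm_num

lemma secondDiff_global (φ f1 f2 : ℝ → ℂ) (C β : ℝ) (hC : 0 ≤ C) (hβ0 : 0 < β) (hβ1 : β < 1)
    (h0 : ∀ ξ, ‖φ ξ - 1‖ ≤ C * |ξ| ^ β)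
    (hd1 : ∀ y, 0 < y → HasDerivAt φ (f1 y) y) (hd2 : ∀ y, 0 < y → HasDerivAt f1 (f2 y) y)
    (hb : ∀ y, 0 < y → ‖f2 y‖ ≤ C * y ^ (β - 2))
    (hs : ∀ ξ, φ (-ξ) = (starRingEnd ℂ) (φ ξ)) (ξ h : ℝ) (hh : 0 < h) :
    ‖φ (ξ + 2 * h) - 2 * φ (ξ + h) + φ ξ‖
      ≤ 192 * C * h ^ β * (1 + ‖ξ / h‖) ^ (-(2 - β)) := by
  have key : ∀ r, h ≤ r → (1 + ‖ξ / h‖) / 4 ≤ r / h →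
      C * r ^ (β - 2) * h ^ 2 ≤ 192 * C * h ^ β * (1 + ‖ξ / h‖) ^ (-(2 - β)) := by
    intro r hr h4
    have hr0 : 0 < r := by linarith
    have h5 := kernel_lower β ‖ξ / h‖ (r / h) hβ0 hβ1 (norm_nonneg _) (by positivity) h4
    have e : r ^ (β - 2) * h ^ 2 = h ^ β * (r / h) ^ (β - 2) := by
      rw [Real.div_rpow hr0.le hh.le, Real.rpow_sub hh]
      have := (Real.rpow_pos_of_pos hh β).ne'
      rw [Real.rpow_two]
      field_simp
    rw [mul_assoc, e]
    have hp : 0 ≤ (1 + ‖ξ / h‖) ^ (-(2 - β)) := by positivity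
    calc C * (h ^ β * (r / h) ^ (β - 2)) ≤ C * (h ^ β * (16 * (1 + ‖ξ / h‖) ^ (-(2 - β)))) := by
          gcongr
      _ = 16 * (C * h ^ β * (1 + ‖ξ / h‖) ^ (-(2 - β))) := by ring
      _ ≤ 192 * (C * h ^ β * (1 + ‖ξ / h‖) ^ (-(2 - β))) := by
          gcongr; norm_num
      _ = _ := by ring
  have habs : ‖ξ / h‖ = |ξ| / h := by rw [norm_div, Real.norm_eq_abs, Real.norm_eq_abs, abs_of_pos hh]
  rcases le_total h ξ with hξ | hξ
  · refine (secondDiff_bound φ f1 f2 C β hC hβ1 hd1 hd2 hb ξ h (by linarith) hh).trans (key ξ hξ ?_)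
    rw [habs, abs_of_nonneg (by linarith)]
    have : 1 ≤ ξ / h := by rwa [le_div_iff₀ hh, one_mul]
    linarith
  rcases le_total ξ (-3 * h) with hξ2 | hξ2
  · have e : ‖φ (ξ + 2 * h) - 2 * φ (ξ + h) + φ ξ‖
        = ‖φ ((-ξ - 2 * h) + 2 * h) - 2 * φ ((-ξ - 2 * h) + h) + φ (-ξ - 2 * h)‖ := by
      rw [show ξ + 2 * h = -(-ξ - 2 * h) by ring, show ξ + h = -((-ξ - 2 * h) + h) by ring,
        hs, hs]
      nth_rewrite 3 [show ξ = -((-ξ - 2 * h) + 2 * h) by ring]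
      rw [hs, ← RCLike.norm_conj]
      congr 1
      simp [map_ofNat]
      ring
    rw [e]
    refine (secondDiff_bound φ f1 f2 C β hC hβ1 hd1 hd2 hb _ h (by linarith) hh).trans
      (key _ (by linarith) ?_)
    rw [habs, abs_of_nonpos (by linarith), sub_div, mul_div_assoc, div_self hh.ne']
    have : 3 ≤ -ξ / h := by rw [le_div_iff₀ hh]; linarith
    linarith
  · have hφ : ∀ y, |y| ≤ 3 * h → ‖φ y - 1‖ ≤ 3 * C * h ^ β := by
      intro y hy
      refine (h0 y).trans ?_
      have : |y| ^ β ≤ 3 * h ^ β := by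
        calc |y| ^ β ≤ (3 * h) ^ β := Real.rpow_le_rpow (abs_nonneg _) hy hβ0.le
          _ = 3 ^ β * h ^ β := Real.mul_rpow (by norm_num) hh.le
          _ ≤ 3 ^ (1:ℝ) * h ^ β := by
            gcongr; norm_num
          _ = _ := by norm_num
      calc C * |y| ^ β ≤ C * (3 * h ^ β) := by gcongr
        _ = _ := by ring
    have b1 := hφ (ξ + 2 * h) (by rw [abs_le]; constructor <;> linarith)
    have b2 := hφ (ξ + h) (by rw [abs_le]; constructor <;> linarith)
    have b3 := hφ ξ (by rw [abs_le]; constructor <;> linarith)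
    have hu : ‖ξ / h‖ ≤ 3 := by
      rw [habs, div_le_iff₀ hh, abs_le]; constructor <;> linarith
    have h5 := kernel_lower β ‖ξ / h‖ 1 hβ0 hβ1 (norm_nonneg _) one_pos (by linarith)
    rw [Real.one_rpow] at h5
    have e : φ (ξ + 2 * h) - 2 * φ (ξ + h) + φ ξ
      = (φ (ξ + 2 * h) - 1) - (φ (ξ + h) - 1) - (φ (ξ + h) - 1) + (φ ξ - 1) := by ring
    have h6 : ‖φ (ξ + 2 * h) - 2 * φ (ξ + h) + φ ξ‖ ≤ 12 * C * h ^ β := by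
      rw [e]
      have := norm_add_le ((φ (ξ + 2 * h) - 1) - (φ (ξ + h) - 1) - (φ (ξ + h) - 1)) (φ ξ - 1)
      have := norm_sub_le ((φ (ξ + 2 * h) - 1) - (φ (ξ + h) - 1)) (φ (ξ + h) - 1)
      have := norm_sub_le (φ (ξ + 2 * h) - 1) (φ (ξ + h) - 1)
      linarith
    calc _ ≤ 12 * C * h ^ β * 1 := by linarith
      _ ≤ 12 * C * h ^ β * (16 * (1 + ‖ξ / h‖) ^ (-(2 - β))) := by gcongr
      _ = _ := by ring

lemma fourier_decay (φ f1 f2 : ℝ → ℂ) (hint : Integrable φ) (C β : ℝ) (hC : 0 ≤ C)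
    (hβ0 : 0 < β) (hβ1 : β < 1)
    (h0 : ∀ ξ, ‖φ ξ - 1‖ ≤ C * |ξ| ^ β)
    (hd1 : ∀ y, 0 < y → HasDerivAt φ (f1 y) y) (hd2 : ∀ y, 0 < y → HasDerivAt f1 (f2 y) y)
    (hb : ∀ y, 0 < y → ‖f2 y‖ ≤ C * y ^ (β - 2))
    (hs : ∀ ξ, φ (-ξ) = (starRingEnd ℂ) (φ ξ)) :
    ∃ K : ℝ, ∀ x : ℝ, x ≠ 0 →
      ‖∫ ξ : ℝ, Complex.exp (-Complex.I * (ξ : ℂ) * (x : ℂ)) * φ ξ‖ ≤ K * |x| ^ (-(1 + β)) := by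
  set J := ∫ u : ℝ, (1 + ‖u‖) ^ (-(2 - β)) with hJ
  have hJi : Integrable (fun u : ℝ => (1 + ‖u‖) ^ (-(2 - β))) :=
    integrable_one_add_norm (by simp; linarith)
  refine ⟨192 * C * J * π ^ (1 + β), fun x hx => ?_⟩
  have hx' : 0 < |x| := abs_pos.mpr hx
  set h := π / |x| with hh
  have hpos : 0 < h := div_pos pi_pos hx'
  set T := ∫ ξ : ℝ, Complex.exp (-Complex.I * (ξ : ℂ) * (x : ℂ)) * φ ξ with hT
  have hE : ∀ g : ℝ → ℂ, Integrable g →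
      Integrable (fun ξ : ℝ => Complex.exp (-Complex.I * (ξ : ℂ) * (x : ℂ)) * g ξ) := by
    intro g hg
    refine hg.bdd_mul (c := 1) (by fun_prop) (ae_of_all _ fun ξ => ?_)
    rw [Complex.norm_exp]; simp
  have hxh : x * h = π ∨ x * h = -π := by
    rcases abs_choice x with h' | h'
    · left; rw [hh, h']; field_simp
    · right; rw [hh, h']; field_simp
  have hexp : Complex.exp (Complex.I * (h : ℂ) * (x : ℂ)) = -1 := by
    rw [mul_assoc, ← Complex.ofReal_mul, mul_comm h x]
    rcases hxh with h' | h' <;> rw [h', mul_comm]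
    · exact Complex.exp_pi_mul_I
    · rw [Complex.ofReal_neg, neg_mul, Complex.exp_neg, Complex.exp_pi_mul_I]; norm_num
  have shift : ∀ g : ℝ → ℂ, ∫ ξ : ℝ, Complex.exp (-Complex.I * (ξ : ℂ) * (x : ℂ)) * g (ξ + h)
      = -∫ ξ : ℝ, Complex.exp (-Complex.I * (ξ : ℂ) * (x : ℂ)) * g ξ := by
    intro g
    rw [← integral_add_right_eq_self
      (fun ξ : ℝ => Complex.exp (-Complex.I * (ξ : ℂ) * (x : ℂ)) * g ξ) h, ← integral_neg]
    congr 1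
    ext ξ
    have : Complex.exp (-Complex.I * (ξ : ℂ) * (x : ℂ))
        = -Complex.exp (-Complex.I * ((ξ + h : ℝ) : ℂ) * (x : ℂ)) := by
      rw [show -Complex.I * (ξ : ℂ) * (x : ℂ) = -Complex.I * ((ξ + h : ℝ) : ℂ) * (x : ℂ)
        + Complex.I * (h : ℂ) * (x : ℂ) by push_cast; ring, Complex.exp_add, hexp]
      ring
    rw [this]; ring
  have i1 : Integrable (fun ξ => φ (ξ + h)) := hint.comp_add_right h
  have i2 : Integrable (fun ξ => φ (ξ + 2 * h)) := hint.comp_add_right (2 * h)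
  have s1 := shift φ
  have s2 := shift (fun ξ => φ (ξ + h))
  rw [s1] at s2
  have hD : ∫ ξ : ℝ, Complex.exp (-Complex.I * (ξ : ℂ) * (x : ℂ)) *
      (φ (ξ + 2 * h) - 2 * φ (ξ + h) + φ ξ) = 4 * T := by
    have e : ∀ ξ : ℝ, Complex.exp (-Complex.I * (ξ : ℂ) * (x : ℂ)) *
      (φ (ξ + 2 * h) - 2 * φ (ξ + h) + φ ξ) =
       Complex.exp (-Complex.I * (ξ : ℂ) * (x : ℂ)) * φ (ξ + h + h)
       - 2 * (Complex.exp (-Complex.I * (ξ : ℂ) * (x : ℂ)) * φ (ξ + h))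
       + Complex.exp (-Complex.I * (ξ : ℂ) * (x : ℂ)) * φ ξ := by
      intro ξ
      rw [show ξ + 2 * h = ξ + h + h by ring]; ring
    simp_rw [e]
    have i2' : Integrable (fun ξ => φ (ξ + h + h)) := by
      simpa [add_assoc, two_mul] using i2
    have i3 : Integrable (fun ξ : ℝ => Complex.exp (-Complex.I * (ξ : ℂ) * (x : ℂ)) * φ (ξ + h + h)
       - 2 * (Complex.exp (-Complex.I * (ξ : ℂ) * (x : ℂ)) * φ (ξ + h))) :=
      (hE _ i2').sub ((hE _ i1).const_mul 2)
    rw [integral_add i3 (hE _ hint),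
      integral_sub (hE _ i2') ((hE _ i1).const_mul 2), integral_const_mul, s1, s2, ← hT]
    ring
  have hbd : ‖4 * T‖ ≤ ∫ ξ : ℝ, 192 * C * h ^ β * (1 + ‖ξ / h‖) ^ (-(2 - β)) := by
    rw [← hD]
    refine norm_integral_le_of_norm_le ((hJi.comp_div hpos.ne').const_mul _) (ae_of_all _ fun ξ => ?_)
    rw [norm_mul, Complex.norm_exp]
    simp only [Complex.mul_re, Complex.neg_re, Complex.I_re, Complex.ofReal_re, Complex.ofReal_im,
      Complex.mul_im, Complex.neg_im, Complex.I_im]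
    ring_nf
    rw [Real.exp_zero, one_mul]
    have := secondDiff_global φ f1 f2 C β hC hβ0 hβ1 h0 hd1 hd2 hb hs ξ h hpos
    ring_nf at this
    exact this
  rw [integral_const_mul, Measure.integral_comp_div (fun u : ℝ => (1 + ‖u‖) ^ (-(2 - β))) h,
    smul_eq_mul, abs_of_pos hpos, ← hJ, norm_mul] at hbd
  have hJ0 : 0 ≤ J := integral_nonneg fun u => by positivity
  have e : h ^ β * h = π ^ (1 + β) * |x| ^ (-(1 + β)) := by
    rw [← Real.rpow_add_one hpos.ne', hh, Real.div_rpow pi_pos.le hx'.le, Real.rpow_neg hx'.le,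
      div_eq_mul_inv, add_comm β]
  have hT0 := norm_nonneg T
  have h4 : ‖(4:ℂ)‖ = 4 := by norm_num
  rw [h4] at hbd
  calc ‖T‖ ≤ 4 * ‖T‖ := by linarith
    _ ≤ _ := hbd
    _ = 192 * C * J * (h ^ β * h) := by ring
    _ = _ := by rw [e]; ring

lemma exp_power_bounds (a : ℝ) (ha : 0 < a) (s : ℝ) (hs : 0 ≤ s) :
    s * Real.exp (-a * s) ≤ (1 + 1 / a + 2 / a ^ 2) * s ^ (1 / 4 : ℝ) ∧
    s ^ 2 * Real.exp (-a * s) ≤ (1 + 1 / a + 2 / a ^ 2) * s ^ (1 / 4 : ℝ) := by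
  have hE : Real.exp (-a * s) ≤ 1 := by
    rw [Real.exp_le_one_iff]; nlinarith
  have hE0 := Real.exp_pos (-a * s)
  have hp : 0 ≤ s ^ (1 / 4 : ℝ) := by positivity
  have ha1 : 0 < 1 / a := by positivity
  have ha2 : 0 < 2 / a ^ 2 := by positivity
  rcases le_total s 1 with h | h
  · have h1 : s ≤ s ^ (1 / 4 : ℝ) := by
      rcases hs.eq_or_lt with h0 | h0
      · rw [← h0]; positivity
      · calc s = s ^ (1:ℝ) := (Real.rpow_one s).symm
          _ ≤ _ := Real.rpow_le_rpow_of_exponent_ge h0 h (by norm_num)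
    constructor <;> nlinarith
  · have h1 : 1 ≤ s ^ (1 / 4 : ℝ) := Real.one_le_rpow h (by norm_num)
    have q := Real.quadratic_le_exp_of_nonneg (x := a * s) (by positivity)
    have e : Real.exp (-a * s) * Real.exp (a * s) = 1 := by
      rw [← Real.exp_add]; simp
    have k1 : s * Real.exp (-a * s) ≤ 1 / a := by
      rw [le_div_iff₀ ha]
      nlinarith [mul_le_mul_of_nonneg_left q hE0.le, mul_nonneg hE0.le (sq_nonneg (a * s))]
    have k2 : s ^ 2 * Real.exp (-a * s) ≤ 2 / a ^ 2 := by
      rw [le_div_iff₀ (by positivity)]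
      nlinarith [mul_le_mul_of_nonneg_left q hE0.le,
        mul_nonneg hE0.le (show 0 ≤ a * s by positivity)]
    constructor <;> nlinarith

lemma exp_sub_one_bound (c : ℂ) (hc : 0 < c.re) (s : ℝ) (hs : 0 ≤ s) :
    ‖Complex.exp (-c * (s : ℂ)) - 1‖ ≤ 2 * ‖c‖ ^ (1 / 4 : ℝ) * s ^ (1 / 4 : ℝ) := by
  rw [mul_assoc, ← Real.mul_rpow (norm_nonneg _) hs]
  have hn : ‖-c * (s : ℂ)‖ = ‖c‖ * s := by
    rw [norm_mul, norm_neg, Complex.norm_real, Real.norm_eq_abs, abs_of_nonneg hs]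
  have hz : 0 ≤ ‖c‖ * s := by positivity
  rcases le_total (‖c‖ * s) 1 with h | h
  · have := Complex.norm_exp_sub_one_le (x := -c * (s : ℂ)) (by rw [hn]; exact h)
    rw [hn] at this
    refine this.trans ?_
    have h1 : ‖c‖ * s ≤ (‖c‖ * s) ^ (1 / 4 : ℝ) := by
      rcases hz.eq_or_lt with h0 | h0
      · rw [← h0]; positivity
      · calc ‖c‖ * s = (‖c‖ * s) ^ (1:ℝ) := (Real.rpow_one _).symm
          _ ≤ _ := Real.rpow_le_rpow_of_exponent_ge h0 h (by norm_num)
    linarith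
  · have h1 : 1 ≤ (‖c‖ * s) ^ (1 / 4 : ℝ) := Real.one_le_rpow h (by norm_num)
    have h2 : ‖Complex.exp (-c * (s : ℂ))‖ ≤ 1 := by
      rw [Complex.norm_exp, Real.exp_le_one_iff]
      simp; positivity
    have := norm_sub_le (Complex.exp (-c * (s : ℂ))) 1
    rw [norm_one] at this
    linarith

/-- First derivative of `y ↦ exp (-c y^α)`. -/
noncomputable def pdf1 (c : ℂ) (α y : ℝ) : ℂ :=
  Complex.exp (-c * ((y ^ α : ℝ) : ℂ)) * (-c * ((α * y ^ (α - 1) : ℝ) : ℂ))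

/-- Second derivative of `y ↦ exp (-c y^α)`. -/
noncomputable def pdf2 (c : ℂ) (α y : ℝ) : ℂ :=
  pdf1 c α y * (-c * ((α * y ^ (α - 1) : ℝ) : ℂ)) +
  Complex.exp (-c * ((y ^ α : ℝ) : ℂ)) * (-c * ((α * ((α - 1) * y ^ (α - 1 - 1)) : ℝ) : ℂ))

lemma hasDerivAt_pd0 (c : ℂ) (α y : ℝ) (hy : 0 < y) :
    HasDerivAt (fun y : ℝ => Complex.exp (-c * ((y ^ α : ℝ) : ℂ))) (pdf1 c α y) y :=
  (((Real.hasDerivAt_rpow_const (p := α) (Or.inl hy.ne')).ofReal_comp).const_mul (-c)).cexp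

lemma hasDerivAt_pd1 (c : ℂ) (α y : ℝ) (hy : 0 < y) :
    HasDerivAt (pdf1 c α) (pdf2 c α y) y :=
  (hasDerivAt_pd0 c α y hy).mul
    (((Real.hasDerivAt_rpow_const (p := α - 1) (Or.inl hy.ne')).const_mul α).ofReal_comp.const_mul
      (-c))

lemma pd2_bound (c : ℂ) (hc : 0 < c.re) (α : ℝ) (hα : 0 < α) (hα2 : α ≤ 2) (y : ℝ) (hy : 0 < y) :
    ‖pdf2 c α y‖ ≤ (4 * ‖c‖ ^ 2 + 2 * ‖c‖) * (1 + 1 / c.re + 2 / c.re ^ 2) * y ^ (α / 4 - 2) := by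
  have hs : 0 ≤ y ^ α := by positivity
  obtain ⟨b1, b2⟩ := exp_power_bounds c.re hc (y ^ α) hs
  set B := (1 + 1 / c.re + 2 / c.re ^ 2) with hB
  have hB0 : 0 ≤ B := by positivity
  have e14 : (y ^ α) ^ (1 / 4 : ℝ) = y ^ (α / 4 - 2) * y ^ 2 := by
    rw [← Real.rpow_mul hy.le, ← Real.rpow_two, ← Real.rpow_add hy]; ring_nf
  have e1 : y ^ (α - 1) = y ^ α / y := by rw [Real.rpow_sub_one hy.ne']
  have e2 : y ^ (α - 1 - 1) = y ^ α / y ^ 2 := by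
    rw [Real.rpow_sub_one hy.ne', Real.rpow_sub_one hy.ne']; field_simp
  have hE : ‖Complex.exp (-c * ((y ^ α : ℝ) : ℂ))‖ = Real.exp (-c.re * y ^ α) := by
    rw [Complex.norm_exp]; simp
  set S := y ^ α with hS
  set E := Real.exp (-c.re * S) with hEd
  have hE0 : 0 < E := Real.exp_pos _
  have n1 : ‖-c * ((α * y ^ (α - 1) : ℝ) : ℂ)‖ ≤ ‖c‖ * (2 * (S / y)) := by
    rw [norm_mul, norm_neg, Complex.norm_real, Real.norm_eq_abs, e1, abs_of_nonneg (by positivity)]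
    gcongr
  have n2 : ‖-c * ((α * ((α - 1) * y ^ (α - 1 - 1)) : ℝ) : ℂ)‖ ≤ ‖c‖ * (2 * (S / y ^ 2)) := by
    rw [norm_mul, norm_neg, Complex.norm_real, Real.norm_eq_abs, e2, abs_mul, abs_mul,
      abs_of_pos hα, abs_of_nonneg (show 0 ≤ S / y ^ 2 by positivity)]
    have : |α - 1| ≤ 1 := by rw [abs_le]; constructor <;> linarith
    have h3 : |α - 1| * (S / y ^ 2) ≤ S / y ^ 2 := mul_le_of_le_one_left (by positivity) this
    gcongr
  have hy2 : 0 < y ^ 2 := by positivity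
  calc ‖pdf2 c α y‖ ≤ E * (‖c‖ * (2 * (S / y))) * (‖c‖ * (2 * (S / y)))
        + E * (‖c‖ * (2 * (S / y ^ 2))) := by
        unfold pdf2 pdf1
        refine (norm_add_le _ _).trans ?_
        rw [norm_mul, norm_mul, norm_mul (Complex.exp _), hE]
        gcongr
    _ = (4 * ‖c‖ ^ 2 * (S ^ 2 * E) + 2 * ‖c‖ * (S * E)) / y ^ 2 := by field_simp; ring
    _ ≤ (4 * ‖c‖ ^ 2 * (B * S ^ (1 / 4 : ℝ)) + 2 * ‖c‖ * (B * S ^ (1 / 4 : ℝ))) / y ^ 2 := by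
        gcongr
    _ = _ := by rw [e14]; field_simp

/-- the characteristic function -/
noncomputable def chf (α θ t ξ : ℝ) : ℂ := Complex.exp ((t : ℂ) * rfSymbol α θ ξ)

lemma chf_neg (α θ t ξ : ℝ) : chf α θ t (-ξ) = (starRingEnd ℂ) (chf α θ t ξ) := by
  unfold chf rfSymbol
  rw [← Complex.exp_conj]
  simp only [map_mul, map_neg, ← Complex.exp_conj, Complex.conj_ofReal, Complex.conj_I, abs_neg,
    Real.sign_neg, Complex.ofReal_neg, neg_mul, mul_neg]

lemma chf_nonneg (α θ t ξ : ℝ) (hα : 0 < α) (hξ : 0 ≤ ξ) : chf α θ t ξ =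
    Complex.exp (-((t : ℂ) * Complex.exp ((θ * (π / 2) : ℝ) * Complex.I)) * ((ξ ^ α : ℝ) : ℂ)) := by
  unfold chf rfSymbol
  rcases hξ.eq_or_lt with h | h
  · rw [← h]; simp [Real.zero_rpow hα.ne']
  · rw [Real.sign_of_pos h, abs_of_pos h]
    congr 1
    push_cast
    ring_nf

lemma chf_abs_cases (α θ t : ℝ) (P : ℂ → ℝ → Prop)
    (hP : ∀ z s, P z s → P ((starRingEnd ℂ) z) s)
    (h : ∀ ξ, 0 ≤ ξ → P (chf α θ t ξ) ξ) (ξ : ℝ) : P (chf α θ t ξ) |ξ| := by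
  rcases le_total 0 ξ with h0 | h0
  · rw [abs_of_nonneg h0]; exact h ξ h0
  · rw [abs_of_nonpos h0, ← neg_neg ξ, chf_neg, neg_neg ξ]
    exact hP _ _ (h _ (by linarith))

lemma c_re_pos (α θ : ℝ) (hθ : |θ| ≤ min α (2 - α)) (h1 : (α, θ) ≠ (1, 1))
    (h2 : (α, θ) ≠ (1, -1)) (t : ℝ) (ht : 0 < t) :
    0 < ((t : ℂ) * Complex.exp ((θ * (π / 2) : ℝ) * Complex.I)).re := by
  rw [Complex.re_ofReal_mul, Complex.exp_ofReal_mul_I_re]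
  refine mul_pos ht (Real.cos_pos_of_mem_Ioo ?_)
  have ha := hθ.trans (min_le_left _ _)
  have hb := hθ.trans (min_le_right _ _)
  rw [abs_le] at ha hb
  have l1 : θ < 1 := by
    refine lt_of_le_of_ne (by linarith) fun h => h1 ?_
    rw [h]; congr 1; linarith
  have l2 : -1 < θ := by
    refine lt_of_le_of_ne (by linarith) fun h => h2 ?_
    rw [← h]; congr 1; linarith
  have := pi_pos
  constructor <;> nlinarith

lemma chf_continuous (α θ t : ℝ) (hα : 0 < α) : Continuous (chf α θ t) := by
  set c := (t : ℂ) * Complex.exp ((θ * (π / 2) : ℝ) * Complex.I)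
  have hg : Continuous (fun ξ : ℝ => Complex.exp (-c * ((|ξ| ^ α : ℝ) : ℂ))) := by
    have : Continuous (fun ξ : ℝ => |ξ| ^ α) := continuous_abs.rpow_const (fun _ => Or.inr hα.le)
    fun_prop
  have : chf α θ t = fun ξ => if 0 ≤ ξ then Complex.exp (-c * ((|ξ| ^ α : ℝ) : ℂ))
      else (starRingEnd ℂ) (Complex.exp (-c * ((|ξ| ^ α : ℝ) : ℂ))) := by
    ext ξ
    split_ifs with h
    · rw [chf_nonneg α θ t ξ hα h, abs_of_nonneg h]
    · push Not at h
      rw [← neg_neg ξ, chf_neg, chf_nonneg α θ t _ hα (by linarith), neg_neg, abs_of_neg h]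
  rw [this]
  refine Continuous.if_le hg (Complex.continuous_conj.comp hg) continuous_const continuous_id ?_
  intro x hx
  have hx' : 0 = x := hx
  simp [← hx', Real.zero_rpow hα.ne']

lemma chf_integrable (α θ t : ℝ) (hα : 0 < α)
    (hc : 0 < ((t : ℂ) * Complex.exp ((θ * (π / 2) : ℝ) * Complex.I)).re) :
    Integrable (chf α θ t) := by
  set c := (t : ℂ) * Complex.exp ((θ * (π / 2) : ℝ) * Complex.I) with hcd
  have hI := integrableOn_rpow_mul_exp_neg_mul_rpow (p := α) (s := 0) (b := c.re)
    (by norm_num) hα hc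
  have hR : Integrable (fun ξ : ℝ => Real.exp (-c.re * ‖ξ‖ ^ α)) := by
    refine (integrable_fun_norm_addHaar (volume : Measure ℝ)
      (f := fun y : ℝ => Real.exp (-c.re * y ^ α))).mpr ?_
    simpa using hI
  refine hR.mono' (chf_continuous α θ t hα).aestronglyMeasurable (ae_of_all _ fun ξ => ?_)
  refine chf_abs_cases α θ t (fun z s => ‖z‖ ≤ Real.exp (-c.re * s ^ α)) ?_ ?_ ξ
  · intro z s hz
    rw [RCLike.norm_conj]
    exact hz
  · intro y hy
    rw [chf_nonneg α θ t y hα hy, ← hcd, Complex.norm_exp]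
    simp

theorem heatG_bound (α θ : ℝ) (hα : 0 < α) (hα2 : α ≤ 2) (t : ℝ)
    (hc : 0 < ((t : ℂ) * Complex.exp ((θ * (π / 2) : ℝ) * Complex.I)).re) :
    ∃ K : ℝ, ∀ x : ℝ, x ≠ 0 →
      ‖∫ ξ : ℝ, Complex.exp (-Complex.I * (ξ : ℂ) * (x : ℂ)) * chf α θ t ξ‖
        ≤ K * |x| ^ (-(1 + α / 4)) := by
  set c := (t : ℂ) * Complex.exp ((θ * (π / 2) : ℝ) * Complex.I) with hcd
  set C1 := 2 * ‖c‖ ^ (1 / 4 : ℝ)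
  set C2 := (4 * ‖c‖ ^ 2 + 2 * ‖c‖) * (1 + 1 / c.re + 2 / c.re ^ 2)
  have hC1 : 0 ≤ C1 := by positivity
  have hC2 : 0 ≤ C2 := by positivity
  refine fourier_decay (chf α θ t) (pdf1 c α) (pdf2 c α) (chf_integrable α θ t hα hc) (C1 + C2)
    (α / 4) (by positivity) (by positivity) (by linarith) ?_ ?_
    (fun y hy => hasDerivAt_pd1 c α y hy) ?_ (chf_neg α θ t)
  · refine chf_abs_cases α θ t (fun z s => ‖z - 1‖ ≤ (C1 + C2) * s ^ (α / 4)) ?_ ?_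
    · intro z s hz
      rw [← RCLike.norm_conj]
      simpa using hz
    · intro ξ hξ
      rw [chf_nonneg α θ t ξ hα hξ, ← hcd]
      refine (exp_sub_one_bound c hc (ξ ^ α) (by positivity)).trans ?_
      rw [← Real.rpow_mul hξ, show α * (1 / 4) = α / 4 by ring]
      gcongr
      linarith
  · intro y hy
    refine (hasDerivAt_pd0 c α y hy).congr_of_eventuallyEq ?_
    filter_upwards [lt_mem_nhds hy] with z hz
    exact chf_nonneg α θ t z hα hz.le
  · intro y hy
    refine (pd2_bound c hc α hα hα2 y hy).trans ?_
    gcongr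
    linarith

lemma heatG_eq (α θ x t : ℝ) : heatG α θ x t =
    ((1 / (2 * π) : ℝ) : ℂ) * FourierTransform.fourier (chf α θ t) (x / (2 * π)) := by
  unfold heatG
  rw [Real.fourier_real_eq_integral_exp_smul]
  congr 2
  ext ξ
  rw [smul_eq_mul]
  unfold chf
  congr 2
  have : (π : ℂ) ≠ 0 := by exact_mod_cast pi_ne_zero
  push_cast
  field_simp

lemma heatG_real (α θ x t : ℝ) : ((heatKer α θ x t : ℝ) : ℂ) = heatG α θ x t := by
  unfold heatKer
  refine Complex.conj_eq_iff_re.mp ?_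
  unfold heatG
  rw [map_mul, Complex.conj_ofReal, ← integral_conj,
    ← integral_neg_eq_self (fun ξ : ℝ => (starRingEnd ℂ)
      (Complex.exp (-Complex.I * (ξ : ℂ) * (x : ℂ)) * Complex.exp ((t : ℂ) * rfSymbol α θ ξ)))]
  congr 2
  ext ξ
  have := chf_neg α θ t ξ
  unfold chf at this
  rw [this, map_mul, Complex.conj_conj, ← Complex.exp_conj]
  simp

lemma fourier_chf_integrable (α θ : ℝ) (hα : 0 < α) (hα2 : α ≤ 2) (t : ℝ)
    (hc : 0 < ((t : ℂ) * Complex.exp ((θ * (π / 2) : ℝ) * Complex.I)).re) :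
    Integrable (fun x => heatG α θ x t) := by
  obtain ⟨K, hK⟩ := heatG_bound α θ hα hα2 t hc
  have hi := chf_integrable α θ t hα hc
  have hcont : Continuous (fun x => heatG α θ x t) := by
    simp_rw [heatG_eq]
    have : Continuous (FourierTransform.fourier (chf α θ t)) :=
      VectorFourier.fourierIntegral_continuous Real.continuous_fourierChar
        (by fun_prop) hi
    fun_prop
  set A := ∫ ξ, ‖chf α θ t ξ‖ with hA
  have hA0 : 0 ≤ A := integral_nonneg fun _ => norm_nonneg _
  have hr : 0 < 1 + α / 4 := by positivity
  have hdom : Integrable (fun x : ℝ => ((1 / (2 * π)) * ((A + |K|) * 2 ^ (1 + α / 4))) *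
      (1 + ‖x‖) ^ (-(1 + α / 4))) :=
    (integrable_one_add_norm (by simp; linarith)).const_mul _
  refine hdom.mono' hcont.aestronglyMeasurable (ae_of_all _ fun x => ?_)
  have hG : ‖heatG α θ x t‖ = 1 / (2 * π) *
      ‖∫ ξ : ℝ, Complex.exp (-Complex.I * (ξ : ℂ) * (x : ℂ)) * chf α θ t ξ‖ := by
    unfold heatG
    rw [norm_mul, Complex.norm_real, Real.norm_eq_abs, abs_of_pos (by positivity)]
    rfl
  rw [hG, mul_assoc]
  refine mul_le_mul_of_nonneg_left ?_ (by positivity)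
  have hpow : ∀ v : ℝ, 0 < v → 1 + ‖x‖ ≤ 2 * v →
      v ^ (-(1 + α / 4)) ≤ 2 ^ (1 + α / 4) * (1 + ‖x‖) ^ (-(1 + α / 4)) := by
    intro v hv h
    have h1 : (2 * v) ^ (-(1 + α / 4)) ≤ (1 + ‖x‖) ^ (-(1 + α / 4)) :=
      Real.rpow_le_rpow_of_nonpos (by positivity) h (by linarith)
    rw [Real.mul_rpow (by norm_num) hv.le, Real.rpow_neg (by norm_num : (0:ℝ) ≤ 2)] at h1
    have h2 : (0:ℝ) < 2 ^ (1 + α / 4) := by positivity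
    calc v ^ (-(1 + α / 4)) = 2 ^ (1 + α / 4) * ((2 ^ (1 + α / 4))⁻¹ * v ^ (-(1 + α / 4))) := by
          field_simp
      _ ≤ _ := by gcongr
  have hp : 0 ≤ 2 ^ (1 + α / 4) * (1 + ‖x‖) ^ (-(1 + α / 4)) := by positivity
  rw [mul_assoc]
  rcases le_total |x| 1 with h | h
  · have := hpow 1 one_pos (by rw [Real.norm_eq_abs]; linarith)
    rw [Real.one_rpow] at this
    have hle : ‖∫ ξ : ℝ, Complex.exp (-Complex.I * (ξ : ℂ) * (x : ℂ)) * chf α θ t ξ‖ ≤ A := by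
      refine norm_integral_le_of_norm_le hi.norm (ae_of_all _ fun ξ => ?_)
      rw [norm_mul, Complex.norm_exp]; simp
    nlinarith [abs_nonneg K]
  · have := hpow |x| (by linarith) (by rw [Real.norm_eq_abs]; linarith)
    refine (hK x (abs_pos.mp (by linarith))).trans ?_
    have h3 : 0 ≤ |x| ^ (-(1 + α / 4)) := by positivity
    calc K * |x| ^ (-(1 + α / 4)) ≤ (A + |K|) * |x| ^ (-(1 + α / 4)) := by
          gcongr; linarith [le_abs_self K]
      _ ≤ _ := by gcongr

/-- The Fourier transform (convention `F[g](ξ) = ∫ e^{iξx} g(x) dx`) of the Riesz–Feller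
heat kernel is `e^{tψ^α_θ(ξ)}`. -/
theorem heat_kernel_fourier (α θ : ℝ) (hα : 0 < α) (hα2 : α ≤ 2)
    (hθ : |θ| ≤ min α (2 - α)) (h1 : (α, θ) ≠ (1, 1)) (h2 : (α, θ) ≠ (1, -1))
    (t : ℝ) (ht : 0 < t) :
    Integrable (fun x : ℝ => heatKer α θ x t) ∧
    ∀ ξ : ℝ, ∫ x : ℝ, Complex.exp (Complex.I * (ξ : ℂ) * (x : ℂ)) * ((heatKer α θ x t : ℝ) : ℂ)
      = Complex.exp ((t : ℂ) * rfSymbol α θ ξ) := by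
  have hc := c_re_pos α θ hθ h1 h2 t ht
  have hG := fourier_chf_integrable α θ hα hα2 t hc
  refine ⟨hG.re, fun ξ => ?_⟩
  simp_rw [heatG_real]
  have hpi : (0:ℝ) < 2 * π := by positivity
  have hF : Integrable (FourierTransform.fourier (chf α θ t)) := by
    have := (hG.comp_mul_left' hpi.ne').const_mul ((2 * π : ℝ) : ℂ)
    refine this.congr (ae_of_all _ fun x => ?_)
    simp only [heatG_eq]
    rw [mul_div_cancel_left₀ _ hpi.ne', ← mul_assoc, ← Complex.ofReal_mul,
      mul_one_div_cancel hpi.ne']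
    simp
  have inv := congrFun ((chf_continuous α θ t hα).fourierInv_fourier_eq
    (chf_integrable α θ t hα hc) hF) ξ
  change _ = chf α θ t ξ
  rw [← inv, Real.fourierInv_eq']
  have e : ∀ x : ℝ, Complex.exp (Complex.I * (ξ : ℂ) * (x : ℂ)) * heatG α θ x t =
      ((1 / (2 * π) : ℝ) : ℂ) * (fun v : ℝ => Complex.exp (((2 * π * inner ℝ v ξ : ℝ) : ℂ) * Complex.I) •
        FourierTransform.fourier (chf α θ t) v) (x / (2 * π)) := by
    intro x
    rw [heatG_eq]
    have : Complex.I * (ξ : ℂ) * (x : ℂ)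
        = ((2 * π * inner ℝ (x / (2 * π)) ξ : ℝ) : ℂ) * Complex.I := by
      have : (π : ℂ) ≠ 0 := by exact_mod_cast pi_ne_zero
      simp only [RCLike.inner_apply, conj_trivial]
      push_cast
      field_simp
    simp only [smul_eq_mul]
    rw [this]; ring
  simp_rw [e]
  rw [integral_const_mul, Measure.integral_comp_div
    (fun v : ℝ => Complex.exp (((2 * π * inner ℝ v ξ : ℝ) : ℂ) * Complex.I) •
        FourierTransform.fourier (chf α θ t) v) (2 * π), abs_of_pos hpi, Complex.real_smul, ← mul_assoc,
    ← Complex.ofReal_mul, one_div_mul_cancel hpi.ne', Complex.ofReal_one, one_mul]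
end
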